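/- arXiv:2511.00692 — 4 statements merged into one kernel-verified Lean document; each statement's English description precedes it below -/
import Mathlib

section
/- Let x > 0 and let p₁, …, p_k be k distinct points in the unit square [0,1]² ⊆ ℝ² whose pairwise distances are all at least 2x. Then k · π · x² ≤ (π/√12) · (1 + 2x)²; equivalently, 12^{1/4} · √k · x ≤ 1 + 2x. (This is the packing-density bound for disk packings in the tiling domain [−x,1+x]².) -/
open Real Metric

open MeasureTheory in
lemma sector_volume_le (R φ : ℝ) (hR : 0 < R) (h0 : 0 ≤ φ) :
    volume {z : ℂ | ‖z‖ < R ∧ cos φ * ‖z‖ < z.re} ≤ ENNReal.ofReal (φ * R ^ 2) := by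
  have hm : MeasurableSet {z : ℂ | ‖z‖ < R ∧ cos φ * ‖z‖ < z.re} := by
    exact (measurableSet_lt (by fun_prop) (by fun_prop) : MeasurableSet {z : ℂ | ‖z‖ < R}).inter
      (measurableSet_lt (by fun_prop) (by fun_prop) :
        MeasurableSet {z : ℂ | cos φ * ‖z‖ < z.re})
  rw [← lintegral_indicator_one hm, ← Complex.lintegral_comp_polarCoord_symm]
  have key : ∀ q ∈ polarCoord.target, (ENNReal.ofReal q.1 • 
      ({z : ℂ | ‖z‖ < R ∧ cos φ * ‖z‖ < z.re}.indicator (1 : ℂ → ENNReal)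
        (Complex.polarCoord.symm q))) ≤
      (Set.Ioo 0 R ×ˢ Set.Ioo (-φ) φ).indicator (fun q : ℝ × ℝ => ENNReal.ofReal q.1) q := by
    rintro ⟨r, t⟩ hq
    simp only [polarCoord_target, Set.mem_prod, Set.mem_Ioi, Set.mem_Ioo] at hq
    obtain ⟨hr, ht1, ht2⟩ := hq
    by_cases h : Complex.polarCoord.symm (r, t) ∈ {z : ℂ | ‖z‖ < R ∧ cos φ * ‖z‖ < z.re}
    · have h' := h
      simp only [Set.mem_ofPred_eq, Complex.norm_polarCoord_symm, abs_of_pos hr] at h'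
      obtain ⟨h1, h2⟩ := h'
      have h3 : (Complex.polarCoord.symm (r, t)).re = r * cos t := by
        rw [Complex.polarCoord_symm_apply]; simp [← Complex.ofReal_cos]
      rw [h3] at h2
      have h4 : cos φ < cos |t| := by rw [cos_abs]; nlinarith
      have h5 : |t| < φ := by
        by_contra hc
        push Not at hc
        have := cos_le_cos_of_nonneg_of_le_pi h0 (abs_le.2 ⟨ht1.le, ht2.le⟩) hc
        linarith
      rw [Set.indicator_of_mem h, Set.indicator_of_mem]
      · simp
      · exact ⟨⟨hr, h1⟩, abs_lt.1 h5⟩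
    · rw [Set.indicator_of_notMem h]; simp
  refine (setLIntegral_mono' polarCoord.open_target.measurableSet key).trans ?_
  refine (setLIntegral_le_lintegral _ _).trans ?_
  rw [lintegral_indicator (by measurability), Measure.volume_eq_prod,
    ← Measure.prod_restrict, lintegral_prod _ (by fun_prop)]
  simp only [lintegral_const, Measure.restrict_apply MeasurableSet.univ, Set.univ_inter, Real.volume_Ioo]
  rw [lintegral_mul_const _ (by fun_prop), ← ofReal_integral_eq_lintegral_ofReal]
  · rw [← integral_Ioc_eq_integral_Ioo, ← intervalIntegral.integral_of_le hR.le, integral_id,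
      ← ENNReal.ofReal_mul (by nlinarith)]
    apply ENNReal.ofReal_le_ofReal
    linarith
  · exact (continuous_id.integrableOn_Icc (a := 0) (b := R)).mono_set Set.Ioo_subset_Icc_self
  · filter_upwards [ae_restrict_mem measurableSet_Ioo] with a ha using ha.1.le

open MeasureTheory in
lemma le_triangle_volume (h t : ℝ) (hh : 0 ≤ h) (ht : 0 ≤ t) :
    ENNReal.ofReal (h ^ 2 * t) ≤ volume {z : ℂ | 0 < z.re ∧ z.re < h ∧ |z.im| < z.re * t} := by
  rw [← Complex.volume_preserving_equiv_real_prod.symm.measure_preimage_equiv]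
  have : regionBetween (fun u : ℝ => - (u * t)) (fun u => u * t) (Set.Ioo 0 h) ⊆
    (Complex.measurableEquivRealProd.symm ⁻¹' {z : ℂ | 0 < z.re ∧ z.re < h ∧ |z.im| < z.re * t}) := by
    rintro ⟨u, v⟩ ⟨⟨h1, h2⟩, h3⟩
    exact ⟨h1, h2, abs_lt.2 h3⟩
  refine le_trans ?_ (measure_mono this)
  rw [Measure.volume_eq_prod, volume_regionBetween_eq_integral]
  · apply ENNReal.ofReal_le_ofReal
    rw [← integral_Ioc_eq_integral_Ioo, ← intervalIntegral.integral_of_le hh]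
    have : ∀ y : ℝ, ((fun u => u * t) - (fun u => -(u*t))) y = (2 * t) * y := by
      intro y; simp; ring
    simp_rw [this]
    rw [intervalIntegral.integral_const_mul, integral_id]
    linarith
  · exact ((by fun_prop : Continuous (fun u : ℝ => -(u*t))).integrableOn_Icc (a := 0) (b := h)).mono_set Set.Ioo_subset_Icc_self
  · exact ((by fun_prop : Continuous (fun u : ℝ => (u*t))).integrableOn_Icc (a := 0) (b := h)).mono_set Set.Ioo_subset_Icc_self
  · exact measurableSet_Ioo
  · intro y hy
    have := mul_nonneg hy.1.le ht
    linarith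

lemma sin_ratio (y : ℝ) (h0 : 0 ≤ y) (h1 : y ≤ π / 3) : 3 * √3 / (2 * π) * y ≤ sin y := by
  have hpi := pi_pos
  have hc := strictConcaveOn_sin_Icc.concaveOn
  have m0 : (0 : ℝ) ∈ Set.Icc 0 π := ⟨le_rfl, hpi.le⟩
  have m1 : π / 3 ∈ Set.Icc 0 π := ⟨by positivity, by linarith⟩
  have n0 : 0 ≤ 1 - 3 * y / π := by rw [sub_nonneg, div_le_one hpi]; linarith
  have n1 : 0 ≤ 3 * y / π := by positivity
  have := hc.2 m0 m1 n0 n1 (by ring)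
  simp only [smul_eq_mul, sin_zero, sin_pi_div_three, mul_zero, zero_add] at this
  have e : 3 * y / π * (π / 3) = y := by field_simp
  rw [e] at this
  refine le_trans (le_of_eq ?_) this
  field_simp

open MeasureTheory in
lemma cap_le_real (R d : ℝ) (hR : 0 < R) (hd : √3 * R ≤ d) :
    volume.real {z : ℂ | ‖z‖ < R ∧ d ≤ 2 * z.re} ≤
      (1 - 3 * √3 / (2 * π)) * volume.real {z : ℂ | ‖z‖ < R ∧ d * ‖z‖ < 2 * R * z.re} := by
  have hd0 : 0 < d := lt_of_lt_of_le (by positivity) hd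
  have hpi := pi_pos
  rcases le_or_gt (2 * R) d with h | h
  · have e1 : {z : ℂ | ‖z‖ < R ∧ d ≤ 2 * z.re} = ∅ := by
      ext z; simp only [Set.mem_ofPred_eq, Set.mem_empty_iff_false, iff_false]
      rintro ⟨h1, h2⟩
      have := Complex.re_le_norm z
      linarith
    have e2 : {z : ℂ | ‖z‖ < R ∧ d * ‖z‖ < 2 * R * z.re} = ∅ := by
      ext z; simp only [Set.mem_ofPred_eq, Set.mem_empty_iff_false, iff_false]
      rintro ⟨h1, h2⟩
      have := Complex.re_le_norm z
      have := norm_nonneg z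
      nlinarith
    rw [e1, e2]; simp
  set φ := arccos (d / (2 * R)) with hφdef
  have hc : cos φ = d / (2 * R) := by
    apply cos_arccos
    · have : 0 < d / (2 * R) := by positivity
      linarith
    · rw [div_le_one (by positivity)]; exact h.le
  have hd' : d = 2 * R * cos φ := by rw [hc]; field_simp
  have h0 : 0 ≤ φ := arccos_nonneg _
  have h6 : φ ≤ π / 6 := by
    have : arccos (cos (π / 6)) = π / 6 := arccos_cos (by positivity) (by linarith)
    rw [← this, cos_pi_div_six]
    apply arccos_le_arccos
    rw [le_div_iff₀ (by positivity)]; linarith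
  have hcp : 0 < cos φ := by rw [hc]; positivity
  have hsn : 0 ≤ sin φ := sin_nonneg_of_nonneg_of_le_pi h0 (by linarith)
  set S := {z : ℂ | ‖z‖ < R ∧ d * ‖z‖ < 2 * R * z.re}
  set C := {z : ℂ | ‖z‖ < R ∧ d ≤ 2 * z.re}
  set T := {z : ℂ | 0 < z.re ∧ z.re < d / 2 ∧ |z.im| < z.re * tan φ}
  have hSe : S = {z : ℂ | ‖z‖ < R ∧ cos φ * ‖z‖ < z.re} := by
    ext z
    simp only [S, Set.mem_ofPred_eq]
    rw [hd', mul_assoc (2 * R), mul_lt_mul_iff_right₀ (by positivity)]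
  have hSvol : volume S ≤ ENNReal.ofReal (φ * R ^ 2) := by
    rw [hSe]; exact sector_volume_le R φ hR h0
  have hSfin : volume S ≠ ⊤ := ne_top_of_le_ne_top ENNReal.ofReal_ne_top hSvol
  have hSr : volume.real S ≤ φ * R ^ 2 := ENNReal.toReal_le_of_le_ofReal (by positivity) hSvol
  have hTS : T ⊆ S := by
    rintro z ⟨h1, h2, h3⟩
    have hlt : cos φ * ‖z‖ < z.re := by
      have e : (cos φ * ‖z‖) ^ 2 < z.re ^ 2 := by
        rw [mul_pow, Complex.sq_norm, Complex.normSq_apply]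
        have a1 : cos φ * |z.im| < z.re * sin φ := by
          have := mul_lt_mul_of_pos_left h3 hcp
          rwa [tan_eq_sin_div_cos, show cos φ * (z.re * (sin φ / cos φ)) = z.re * sin φ by
            field_simp] at this
        have a2 : (cos φ * |z.im|) ^ 2 < (z.re * sin φ) ^ 2 := by
          apply pow_lt_pow_left₀ a1 (by positivity) (by norm_num)
        rw [mul_pow, sq_abs, mul_pow, sin_sq] at a2
        nlinarith
      exact lt_of_pow_lt_pow_left₀ 2 h1.le e
    rw [hSe]
    refine ⟨?_, hlt⟩
    have : cos φ * ‖z‖ < cos φ * R := by rw [hd'] at h2; linarith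
    exact lt_of_mul_lt_mul_left this hcp.le
  have hCS : C ⊆ S \ T := by
    rintro z ⟨h1, h2⟩
    refine ⟨⟨h1, ?_⟩, ?_⟩
    · nlinarith [mul_lt_mul_of_pos_left h1 hd0]
    · rintro ⟨_, h4, _⟩; linarith
  have hTm : MeasurableSet T := by
    exact (measurableSet_lt (by fun_prop) (by fun_prop) : MeasurableSet {z : ℂ | 0 < z.re}).inter
      ((measurableSet_lt (by fun_prop) (by fun_prop) : MeasurableSet {z : ℂ | z.re < d / 2}).inter
      (measurableSet_lt (by fun_prop) (by fun_prop) :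
        MeasurableSet {z : ℂ | |z.im| < z.re * tan φ}))
  have hTr : (d / 2) ^ 2 * tan φ ≤ volume.real T := by
    have := le_triangle_volume (d / 2) (tan φ) (by positivity)
      (tan_nonneg_of_nonneg_of_le_pi_div_two h0 (by linarith))
    exact (ENNReal.ofReal_le_iff_le_toReal (ne_top_of_le_ne_top hSfin (measure_mono hTS))).1 this
  have hT2 : (d / 2) ^ 2 * tan φ = R ^ 2 * (sin (2 * φ) / 2) := by
    rw [hd', tan_eq_sin_div_cos, sin_two_mul]; field_simp
  have hsr := sin_ratio (2 * φ) (by linarith) (by linarith)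
  have hCr : volume.real C ≤ volume.real S - volume.real T := by
    rw [← measureReal_sdiff hTS hTm hSfin]
    exact measureReal_mono hCS (ne_top_of_le_ne_top hSfin (measure_mono Set.sdiff_subset))
  have h9 : 3 * √3 / (2 * π) * volume.real S ≤ 3 * √3 / (2 * π) * (φ * R ^ 2) := by gcongr
  have hR2 : 0 < R ^ 2 := by positivity
  nlinarith [mul_le_mul_of_nonneg_left hsr hR2.le]

open MeasureTheory ComplexConjugate in
lemma cap_le (R : ℝ) (w : ℂ) (hR : 0 < R) (hw : √3 * R ≤ ‖w‖) :
    volume.real {z : ℂ | ‖z‖ < R ∧ ‖w‖ ^ 2 ≤ 2 * (z * conj w).re} ≤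
      (1 - 3 * √3 / (2 * π)) *
        volume.real {z : ℂ | ‖z‖ < R ∧ ‖w‖ ^ 2 * ‖z‖ < 2 * R * (z * conj w).re} := by
  have hd0 : 0 < ‖w‖ := lt_of_lt_of_le (by positivity) hw
  have hw0 : w ≠ 0 := norm_pos_iff.1 hd0
  have hu : ‖w / (‖w‖ : ℂ)‖ = 1 := by simp [hw0]
  let u : Circle := ⟨w / (‖w‖ : ℂ), by simpa [Submonoid.unitSphere] using hu⟩
  have hmp := (rotation u).measurePreserving
  have hre : ∀ z : ℂ, ((rotation u z) * conj w).re = ‖w‖ * z.re := by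
    intro z
    have : (rotation u z) * conj w = (‖w‖ : ℂ) * z := by
      rw [rotation_apply]
      change w / (‖w‖ : ℂ) * z * conj w = _
      have h1 : w * conj w = (‖w‖ : ℂ) ^ 2 := by
        rw [Complex.mul_conj, Complex.normSq_eq_norm_sq]; push_cast; rfl
      have h2 : (‖w‖ : ℂ) ≠ 0 := by exact_mod_cast hd0.ne'
      field_simp
      linear_combination z * h1
    rw [this, Complex.re_ofReal_mul]
  have hnm : ∀ z : ℂ, ‖rotation u z‖ = ‖z‖ := fun z => (rotation u).norm_map z
  have e1 : volume.real {z : ℂ | ‖z‖ < R ∧ ‖w‖ ^ 2 ≤ 2 * (z * conj w).re} =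
      volume.real {z : ℂ | ‖z‖ < R ∧ ‖w‖ ≤ 2 * z.re} := by
    rw [measureReal_def, measureReal_def,
      ← (rotation u).measurePreserving.measure_preimage_equiv (f := (rotation u).toHomeomorph.toMeasurableEquiv)]
    congr 2
    ext z
    change (‖rotation u z‖ < R ∧ ‖w‖ ^ 2 ≤ 2 * (rotation u z * conj w).re) ↔
      (‖z‖ < R ∧ ‖w‖ ≤ 2 * z.re)
    rw [hnm, hre, show 2 * (‖w‖ * z.re) = ‖w‖ * (2 * z.re) by ring, sq,
      mul_le_mul_iff_right₀ hd0]
  have e2 : volume.real {z : ℂ | ‖z‖ < R ∧ ‖w‖ ^ 2 * ‖z‖ < 2 * R * (z * conj w).re} =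
      volume.real {z : ℂ | ‖z‖ < R ∧ ‖w‖ * ‖z‖ < 2 * R * z.re} := by
    rw [measureReal_def, measureReal_def,
      ← (rotation u).measurePreserving.measure_preimage_equiv (f := (rotation u).toHomeomorph.toMeasurableEquiv)]
    congr 2
    ext z
    change (‖rotation u z‖ < R ∧ ‖w‖ ^ 2 * ‖rotation u z‖ < 2 * R * (rotation u z * conj w).re) ↔
      (‖z‖ < R ∧ ‖w‖ * ‖z‖ < 2 * R * z.re)
    rw [hnm, hre, show 2 * R * (‖w‖ * z.re) = ‖w‖ * (2 * R * z.re) by ring, sq, mul_assoc,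
      mul_lt_mul_iff_right₀ hd0]
  rw [e1, e2]
  exact cap_le_real R ‖w‖ hR hw

lemma triple_aux (R : ℝ) (a b c : ℂ) (ha : ‖a‖ ≤ R) (hb : ‖b‖ < R) (hc : ‖c‖ < R)
    (ha0 : 0 < ‖a‖) (hb0 : 0 < ‖b‖) (hc0 : 0 < ‖c‖)
    (hab : 3 * R ^ 2 ≤ ‖a - b‖ ^ 2) (hac : 3 * R ^ 2 ≤ ‖a - c‖ ^ 2)
    (hbc : 3 * R ^ 2 ≤ ‖b - c‖ ^ 2) : False := by
  have key : ∀ u v : ℂ, ‖u‖ ≤ R → ‖v‖ < R → 0 < ‖u‖ → 0 < ‖v‖ → 3 * R ^ 2 ≤ ‖u - v‖ ^ 2 →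
      2 * inner ℝ u v < - (‖u‖ * ‖v‖) := by
    intro u v hu hv hu0 hv0 h
    rw [norm_sub_sq_real] at h
    nlinarith
  have k1 := key a b ha hb ha0 hb0 hab
  have k2 := key a c ha hc ha0 hc0 hac
  have k3 := key b c hb.le hc hb0 hc0 hbc
  have h0 : 0 ≤ ‖(‖b‖ * ‖c‖) • a + (‖a‖ * ‖c‖) • b + (‖a‖ * ‖b‖) • c‖ ^ 2 := by positivity
  rw [norm_add_sq_real, norm_add_sq_real, inner_add_left] at h0
  simp only [norm_smul, inner_smul_left, inner_smul_right, norm_mul, norm_norm, conj_trivial] at h0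
  generalize ‖a‖ = α at *
  generalize ‖b‖ = β at *
  generalize ‖c‖ = γ at *
  have p1 : 0 < α * β * γ * γ := by positivity
  have p2 : 0 < α * β * γ * β := by positivity
  have p3 : 0 < α * β * γ * α := by positivity
  nlinarith [mul_lt_mul_of_pos_left k1 p1, mul_lt_mul_of_pos_left k2 p2,
    mul_lt_mul_of_pos_left k3 p3]

open ComplexConjugate in
lemma norm_sub_sq_conj (w z : ℂ) : ‖w - z‖ ^ 2 = ‖w‖ ^ 2 - 2 * (z * conj w).re + ‖z‖ ^ 2 := by
  simp only [Complex.sq_norm, Complex.normSq_apply, Complex.sub_re, Complex.sub_im,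
    Complex.mul_re, Complex.conj_re, Complex.conj_im]
  ring

open ComplexConjugate in
lemma triple (R : ℝ) (z w v : ℂ) (hR : 0 < R) (hz : ‖z‖ = R)
    (hw : 3 * R ^ 2 ≤ ‖w‖ ^ 2) (hv : 3 * R ^ 2 ≤ ‖v‖ ^ 2) (hwv : 3 * R ^ 2 ≤ ‖w - v‖ ^ 2)
    (h1 : ‖w‖ ^ 2 < 2 * (z * conj w).re) (h2 : ‖v‖ ^ 2 < 2 * (z * conj v).re) : False := by
  have n1 : ∀ y : ℂ, 3 * R ^ 2 ≤ ‖y‖ ^ 2 → ‖y‖ ^ 2 < 2 * (z * conj y).re →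
      ‖y - z‖ < R ∧ 0 < ‖y - z‖ := by
    intro y hy h
    constructor
    · have := norm_sub_sq_conj y z
      rw [hz] at this
      apply lt_of_pow_lt_pow_left₀ 2 hR.le
      linarith
    · rw [norm_pos_iff]
      intro h0
      have : y = z := sub_eq_zero.1 h0
      rw [this, hz] at hy
      nlinarith
  obtain ⟨a1, a2⟩ := n1 w hw h1
  obtain ⟨b1, b2⟩ := n1 v hv h2
  refine triple_aux R (-z) (w - z) (v - z) (by simp [hz]) a1 b1 (by simpa [hz] using hR) a2 b2 ?_ ?_ ?_
  · rwa [show -z - (w - z) = -w by ring, norm_neg]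
  · rwa [show -z - (v - z) = -v by ring, norm_neg]
  · rwa [show w - z - (v - z) = w - v by ring]

open ComplexConjugate in
lemma triple' (R : ℝ) (z w v : ℂ) (hR : 0 < R)
    (hw : 3 * R ^ 2 ≤ ‖w‖ ^ 2) (hv : 3 * R ^ 2 ≤ ‖v‖ ^ 2) (hwv : 3 * R ^ 2 ≤ ‖w - v‖ ^ 2)
    (h1 : ‖w‖ ^ 2 * ‖z‖ < 2 * R * (z * conj w).re)
    (h2 : ‖v‖ ^ 2 * ‖z‖ < 2 * R * (z * conj v).re) : False := by
  have hz : 0 < ‖z‖ := by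
    rw [norm_pos_iff]; rintro rfl; simp at h1
  have h3 : ∀ y : ℂ, ‖y‖ ^ 2 * ‖z‖ < 2 * R * (z * conj y).re →
      ‖y‖ ^ 2 < 2 * (((R / ‖z‖ : ℝ) : ℂ) * z * conj y).re := by
    intro y hy
    rw [mul_assoc, Complex.re_ofReal_mul]
    rw [← lt_div_iff₀ hz] at hy
    refine hy.trans_eq ?_
    field_simp
  refine triple R (((R / ‖z‖ : ℝ) : ℂ) * z) w v hR ?_ hw hv hwv (h3 w h1) (h3 v h2)
  rw [norm_mul, Complex.norm_real, Real.norm_of_nonneg (by positivity)]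
  field_simp

open MeasureTheory ComplexConjugate in
lemma cell_volume (R : ℝ) (hR : 0 < R) (D : Finset ℂ) (hD : ∀ w ∈ D, √3 * R ≤ ‖w‖)
    (hDD : ∀ w ∈ D, ∀ v ∈ D, w ≠ v → √3 * R ≤ ‖w - v‖) :
    3 * √3 / 2 * R ^ 2 ≤
      volume.real {z : ℂ | ‖z‖ < R ∧ ∀ w ∈ D, 2 * (z * conj w).re < ‖w‖ ^ 2} := by
  have hpi := pi_pos
  have sq3 : ∀ y : ℂ, √3 * R ≤ ‖y‖ → 3 * R ^ 2 ≤ ‖y‖ ^ 2 := by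
    intro y hy
    have := pow_le_pow_left₀ (by positivity) hy 2
    rwa [mul_pow, Real.sq_sqrt (by norm_num)] at this
  set V := {z : ℂ | ‖z‖ < R ∧ ∀ w ∈ D, 2 * (z * conj w).re < ‖w‖ ^ 2}
  let C : ℂ → Set ℂ := fun w => {z : ℂ | ‖z‖ < R ∧ ‖w‖ ^ 2 ≤ 2 * (z * conj w).re}
  let S : ℂ → Set ℂ := fun w => {z : ℂ | ‖z‖ < R ∧ ‖w‖ ^ 2 * ‖z‖ < 2 * R * (z * conj w).re}
  have hball : volume.real (ball (0 : ℂ) R) = π * R ^ 2 := by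
    rw [measureReal_def, Complex.volume_ball]
    simp [hR.le]; ring
  have hbf : volume (ball (0 : ℂ) R) ≠ ⊤ := measure_ball_lt_top.ne
  have hsub : ∀ T : Set ℂ, (∀ z ∈ T, ‖z‖ < R) → volume T ≠ ⊤ := fun T hT =>
    ne_top_of_le_ne_top hbf (measure_mono fun z hz => mem_ball_zero_iff.2 (hT z hz))
  have hcov : ball (0 : ℂ) R ⊆ V ∪ ⋃ w ∈ D, C w := by
    intro z hz
    rw [mem_ball_zero_iff] at hz
    by_cases h : ∀ w ∈ D, 2 * (z * conj w).re < ‖w‖ ^ 2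
    · exact Or.inl ⟨hz, h⟩
    · push Not at h
      obtain ⟨w, hw, h⟩ := h
      exact Or.inr (Set.mem_biUnion hw ⟨hz, h⟩)
  have hU : volume (⋃ w ∈ D, C w) ≠ ⊤ := hsub _ (by
    intro z hz
    simp only [Set.mem_iUnion] at hz
    obtain ⟨w, _, h⟩ := hz
    exact h.1)
  have hV : volume V ≠ ⊤ := hsub _ fun z hz => hz.1
  have i1 : π * R ^ 2 ≤ volume.real V + ∑ w ∈ D, volume.real (C w) := by
    rw [← hball]
    calc _ ≤ volume.real (V ∪ ⋃ w ∈ D, C w) := measureReal_mono hcov (by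
            exact (measure_union_lt_top hV.lt_top hU.lt_top).ne)
      _ ≤ volume.real V + volume.real (⋃ w ∈ D, C w) := measureReal_union_le _ _
      _ ≤ _ := by gcongr; exact measureReal_biUnion_finset_le _ _
  have i2 : ∑ w ∈ D, volume.real (S w) ≤ π * R ^ 2 := by
    rw [← hball, ← measureReal_biUnion_finset (h := fun w _ => hsub _ fun z hz => hz.1)]
    · apply measureReal_mono _ hbf
      intro z hz
      simp only [Set.mem_iUnion] at hz
      obtain ⟨w, _, h⟩ := hz
      exact mem_ball_zero_iff.2 h.1
    · intro w hw v hv hne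
      rw [Function.onFun, Set.disjoint_left]
      intro z h1 h2
      exact triple' R z w v hR (sq3 _ (hD w hw)) (sq3 _ (hD v hv)) (sq3 _ (hDD w hw v hv hne))
        h1.2 h2.2
    · intro w _
      exact (measurableSet_lt (by fun_prop) (by fun_prop) : MeasurableSet {z : ℂ | ‖z‖ < R}).inter
        (measurableSet_lt (by fun_prop) (by fun_prop) :
          MeasurableSet {z : ℂ | ‖w‖ ^ 2 * ‖z‖ < 2 * R * (z * conj w).re})
  have i3 : ∑ w ∈ D, volume.real (C w) ≤ (1 - 3 * √3 / (2 * π)) * ∑ w ∈ D, volume.real (S w) := by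
    rw [Finset.mul_sum]
    exact Finset.sum_le_sum fun w hw => cap_le R w hR (hD w hw)
  have i4 : 0 ≤ 1 - 3 * √3 / (2 * π) := by
    rw [sub_nonneg, div_le_one (by positivity)]
    have : √3 ≤ 2 := by rw [Real.sqrt_le_left (by norm_num)]; norm_num
    nlinarith [pi_gt_three]
  have i5 := mul_le_mul_of_nonneg_left i2 i4
  have i6 : (1 - 3 * √3 / (2 * π)) * (π * R ^ 2) = π * R ^ 2 - 3 * √3 / 2 * R ^ 2 := by
    field_simp
  linarith

open MeasureTheory ComplexConjugate in
lemma pack_volume {ι : Type*} [Fintype ι] [DecidableEq ι] (R : ℝ) (hR : 0 < R) (c : ι → ℂ)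
    (hc : ∀ i j, i ≠ j → √3 * R ≤ ‖c i - c j‖) (a b : ℝ) (hab : a ≤ b)
    (hre : ∀ i, a + R ≤ (c i).re ∧ (c i).re ≤ b - R)
    (him : ∀ i, a + R ≤ (c i).im ∧ (c i).im ≤ b - R) :
    Fintype.card ι * (3 * √3 / 2 * R ^ 2) ≤ (b - a) ^ 2 := by
  let V : ι → Set ℂ := fun i => {z | ‖z - c i‖ < R ∧ ∀ j, j ≠ i → ‖z - c i‖ < ‖z - c j‖}
  have hVm : ∀ i, MeasurableSet (V i) := by
    intro i
    refine (measurableSet_lt (by fun_prop) (by fun_prop) :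
      MeasurableSet {z : ℂ | ‖z - c i‖ < R}).inter ?_
    have : {z : ℂ | ∀ j, j ≠ i → ‖z - c i‖ < ‖z - c j‖} =
        ⋂ j, ⋂ (_ : j ≠ i), {z : ℂ | ‖z - c i‖ < ‖z - c j‖} := by
      ext z; simp
    change MeasurableSet {z : ℂ | ∀ j, j ≠ i → ‖z - c i‖ < ‖z - c j‖}
    rw [this]
    exact MeasurableSet.iInter fun j => MeasurableSet.iInter fun _ =>
      measurableSet_lt (by fun_prop) (by fun_prop)
  have hVv : ∀ i, 3 * √3 / 2 * R ^ 2 ≤ volume.real (V i) := by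
    intro i
    let D : Finset ℂ := (Finset.univ.erase i).image fun j => c j - c i
    have h := cell_volume R hR D ?_ ?_
    · refine h.trans_eq ?_
      rw [measureReal_def, measureReal_def, ← measure_preimage_add_right volume (c i) (V i)]
      congr 2
      ext z
      simp only [V, D, Set.mem_ofPred_eq, Set.mem_preimage, add_sub_cancel_right, Finset.mem_image,
        Finset.mem_erase, Finset.mem_univ, and_true, forall_exists_index, and_imp,
        forall_apply_eq_imp_iff₂]
      refine and_congr_right fun _ => forall_congr' fun j => forall_congr' fun _ => ?_
      rw [show z + c i - c j = -((c j - c i) - z) by ring, norm_neg,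
        ← pow_lt_pow_iff_left₀ (norm_nonneg z) (norm_nonneg _) (two_ne_zero),
        norm_sub_sq_conj (c j - c i) z]
      constructor <;> intro h <;> linarith
    · intro w hw
      simp only [D, Finset.mem_image, Finset.mem_erase, Finset.mem_univ, and_true] at hw
      obtain ⟨j, hj, rfl⟩ := hw
      exact hc j i hj
    · intro w hw v hv hne
      simp only [D, Finset.mem_image, Finset.mem_erase, Finset.mem_univ, and_true] at hw hv
      obtain ⟨j, hj, rfl⟩ := hw
      obtain ⟨l, hl, rfl⟩ := hv
      rw [sub_sub_sub_cancel_right]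
      apply hc
      rintro rfl
      exact hne rfl
  have hbox : volume (Set.Icc a b ×ℂ Set.Icc a b) = ENNReal.ofReal ((b - a) ^ 2) := by
    rw [← Complex.volume_preserving_equiv_real_prod.symm.measure_preimage_equiv]
    have : (Complex.measurableEquivRealProd.symm ⁻¹' (Set.Icc a b ×ℂ Set.Icc a b)) =
      Set.Icc a b ×ˢ Set.Icc a b := by ext ⟨u, v⟩; rfl
    rw [this, Measure.volume_eq_prod, Measure.prod_prod, Real.volume_Icc,
      ← ENNReal.ofReal_mul (by linarith), sq]
  have hVs : ∀ i, V i ⊆ Set.Icc a b ×ℂ Set.Icc a b := by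
    intro i z hz
    have h1 := (Complex.abs_re_le_norm (z - c i)).trans hz.1.le
    have h2 := (Complex.abs_im_le_norm (z - c i)).trans hz.1.le
    rw [abs_le, Complex.sub_re] at h1
    rw [abs_le, Complex.sub_im] at h2
    obtain ⟨a1, a2⟩ := hre i
    obtain ⟨b1, b2⟩ := him i
    rw [Complex.mem_reProdIm]
    refine ⟨⟨?_, ?_⟩, ⟨?_, ?_⟩⟩ <;> linarith
  have hfin : volume (Set.Icc a b ×ℂ Set.Icc a b) ≠ ⊤ := by rw [hbox]; exact ENNReal.ofReal_ne_top
  have hsum : ∑ i, volume.real (V i) ≤ (b - a) ^ 2 := by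
    have : volume.real (Set.Icc a b ×ℂ Set.Icc a b) = (b - a) ^ 2 := by
      rw [measureReal_def, hbox, ENNReal.toReal_ofReal (by positivity)]
    rw [← this, ← measureReal_biUnion_finset
      (h := fun i _ => ne_top_of_le_ne_top hfin (measure_mono (hVs i)))]
    · apply measureReal_mono _ hfin
      exact Set.iUnion₂_subset fun i _ => hVs i
    · intro i _ j _ hne
      rw [Function.onFun, Set.disjoint_left]
      intro z h1 h2
      exact lt_asymm (h1.2 j hne.symm) (h2.2 i hne)
    · exact fun i _ => hVm i
  refine le_trans ?_ hsum
  rw [← nsmul_eq_mul, ← Finset.card_univ]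
  exact Finset.card_nsmul_le_sum _ _ _ fun i _ => hVv i

theorem packing_density_bound_in_square
    (x : ℝ) (hx : 0 < x) (k : ℕ) (p : Fin k → EuclideanSpace ℝ (Fin 2))
    (hinj : Function.Injective p)
    (hsq : ∀ i, ∀ j : Fin 2, p i j ∈ Set.Icc (0 : ℝ) 1)
    (hdist : ∀ i j, i ≠ j → 2 * x ≤ dist (p i) (p j)) :
    (k : ℝ) * π * x ^ 2 ≤ (π / Real.sqrt 12) * (1 + 2 * x) ^ 2 ∧
      (12 : ℝ) ^ ((1 : ℝ) / 4) * Real.sqrt k * x ≤ 1 + 2 * x := by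
  have h3 : (0 : ℝ) < √3 := by positivity
  have h33 : √3 ^ 2 = 3 := Real.sq_sqrt (by norm_num)
  have h12 : √12 = 2 * √3 := by
    rw [show (12 : ℝ) = 2 ^ 2 * 3 by norm_num, Real.sqrt_mul (by norm_num),
      Real.sqrt_sq (by norm_num)]
  set R := 2 * x / √3 with hRdef
  have hR : 0 < R := by positivity
  have hR3 : √3 * R = 2 * x := by rw [hRdef]; field_simp
  set s := 1 + 2 * x with hs
  have hs0 : 0 < s := by positivity
  have hA : 3 * √3 / 2 * R ^ 2 = √12 * x ^ 2 := by
    rw [h12]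
    have : (√3 * R) ^ 2 = (2 * x) ^ 2 := by rw [hR3]
    rw [mul_pow, h33] at this
    linear_combination √3 / 2 * this
  have main : ∀ M : ℕ, (k : ℝ) * M ^ 2 * (√12 * x ^ 2) ≤ (s * M + (1 + 2 * R)) ^ 2 := by
    intro M
    let c : Fin k × Fin M × Fin M → ℂ := fun i =>
      ⟨p i.1 0 + s * (i.2.1 : ℕ), p i.1 1 + s * (i.2.2 : ℕ)⟩
    have sep : ∀ (m n : ℕ) (u v : ℝ), u ∈ Set.Icc (0 : ℝ) 1 → v ∈ Set.Icc (0 : ℝ) 1 → m ≠ n →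
        2 * x ≤ |(u + s * m) - (v + s * n)| := by
      intro m n u v hu hv hmn
      rcases lt_or_gt_of_ne hmn with h | h
      · have : (m : ℝ) + 1 ≤ n := by exact_mod_cast h
        rw [abs_sub_comm]
        refine le_trans ?_ (le_abs_self _)
        nlinarith [hu.1, hu.2, hv.1, hv.2]
      · have : (n : ℝ) + 1 ≤ m := by exact_mod_cast h
        refine le_trans ?_ (le_abs_self _)
        nlinarith [hu.1, hu.2, hv.1, hv.2]
    have hcd : ∀ i j, i ≠ j → √3 * R ≤ ‖c i - c j‖ := by
      rintro ⟨i, m, n⟩ ⟨j, m', n'⟩ hne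
      rw [hR3]
      by_cases hm : (m : ℕ) = m'
      · by_cases hn : (n : ℕ) = n'
        · have hij : i ≠ j := by
            rintro rfl
            exact hne (by rw [Fin.ext hm, Fin.ext hn])
          refine (hdist i j hij).trans_eq ?_
          rw [EuclideanSpace.dist_eq, Complex.norm_def, Complex.normSq_apply]
          simp only [Fin.sum_univ_two, Real.dist_eq, sq_abs, c, Complex.sub_re, Complex.sub_im, hm, hn]
          congr 1
          ring
        · refine le_trans ?_ (Complex.abs_im_le_norm _)
          exact sep n n' _ _ (hsq i 1) (hsq j 1) hn
      · refine le_trans ?_ (Complex.abs_re_le_norm _)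
        exact sep m m' _ _ (hsq i 0) (hsq j 0) hm
    have bd : ∀ (m : Fin M) (u : ℝ), u ∈ Set.Icc (0 : ℝ) 1 →
        -R + R ≤ u + s * (m : ℕ) ∧ u + s * (m : ℕ) ≤ (s * M + 1 + R) - R := by
      intro m u hu
      have h1 : ((m : ℕ) : ℝ) ≤ M := by exact_mod_cast m.2.le
      have h2 : (0 : ℝ) ≤ ((m : ℕ) : ℝ) := by positivity
      constructor <;> nlinarith [hu.1, hu.2, mul_nonneg hs0.le h2]
    have hM0 : (0 : ℝ) ≤ s * M := by positivity
    have h := pack_volume R hR c hcd (-R) (s * M + 1 + R) (by linarith)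
      (fun i => bd i.2.1 _ (hsq i.1 0)) (fun i => bd i.2.2 _ (hsq i.1 1))
    rw [hA] at h
    simp only [Fintype.card_prod, Fintype.card_fin, Nat.cast_mul] at h
    calc _ = (k : ℝ) * (M * M) * (√12 * x ^ 2) := by ring
      _ ≤ _ := h
      _ = _ := by ring
  have hB : √(√12) * √k * x ≤ s := by
    by_contra hcon
    push Not at hcon
    set A := √(√12) * √k * x with hAdef
    have hA0 : 0 ≤ A := by positivity
    have hA2 : A ^ 2 = k * (√12 * x ^ 2) := by
      rw [hAdef, mul_pow, mul_pow, Real.sq_sqrt (by positivity), Real.sq_sqrt (by positivity)]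
      ring
    obtain ⟨M, hM⟩ := exists_nat_gt ((1 + 2 * R) / (A - s))
    rw [div_lt_iff₀ (by linarith)] at hM
    have h1 : (A * M) ^ 2 ≤ (s * M + (1 + 2 * R)) ^ 2 := by
      rw [mul_pow, hA2]
      refine le_trans (le_of_eq ?_) (main M)
      ring
    have h2 := abs_le_of_sq_le_sq' h1 (by positivity)
    nlinarith [h2.2]
  constructor
  · have h4 : k * (√12 * x ^ 2) ≤ s ^ 2 := by
      have := pow_le_pow_left₀ (by positivity) hB 2
      rw [mul_pow, mul_pow, Real.sq_sqrt (by positivity), Real.sq_sqrt (by positivity)] at this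
      linarith
    rw [div_mul_eq_mul_div, le_div_iff₀ (by positivity)]
    nlinarith [mul_le_mul_of_nonneg_left h4 pi_pos.le]
  · have : (12 : ℝ) ^ ((1 : ℝ) / 4) = √(√12) := by
      rw [Real.sqrt_eq_rpow, Real.sqrt_eq_rpow, ← Real.rpow_mul (by norm_num)]
      norm_num
    rw [this]
    exact hB
end

section
/- Let k ≥ 3·10⁵ be an integer, let x > 0, and let p₁, …, p_k be k distinct points in the unit square [0,1]² ⊆ ℝ² whose pairwise distances are all at least 2x. Then x ≤ 1/(12^{1/4}·√k − 2) ≤ 1.002/(12^{1/4}·√k); in particular, the minimum pairwise distance 2x satisfies 2x ≤ (2 · 1.002)/(12^{1/4}·√k). -/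
open Real Metric

lemma inner_radial (a r : ℝ) (ha : 0 ≤ a) (har : a ≤ r) :
    ∫⁻ ρ in Set.Ico a r, ENNReal.ofReal ρ = ENNReal.ofReal ((r ^ 2 - a ^ 2) / 2) := by
  rw [MeasureTheory.setLIntegral_congr MeasureTheory.Ico_ae_eq_Ioc, 
    ← MeasureTheory.ofReal_integral_eq_lintegral_ofReal,
    ← intervalIntegral.integral_of_le har, integral_id]
  · exact (continuous_id.integrableOn_Icc).mono_set Set.Ioc_subset_Icc_self
  · filter_upwards [MeasureTheory.ae_restrict_mem measurableSet_Ioc] with t ht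
    exact ha.trans ht.1.le

lemma polar_volume (A : Set ℂ) (hA : MeasurableSet A) (g : ℝ → ℝ) (hg : Measurable g) (θ r : ℝ)
    (hθ : 0 ≤ θ) (hθπ : θ ≤ π)
    (hgc : ContinuousOn g (Set.Icc (-θ) θ)) (hg0 : ∀ φ ∈ Set.Ioo (-θ) θ, 0 ≤ g φ)
    (hgr : ∀ φ ∈ Set.Ioo (-θ) θ, g φ ≤ r)
    (hAm : ∀ ρ φ : ℝ, 0 < ρ → φ ∈ Set.Ioo (-π) π →
      (Complex.polarCoord.symm (ρ, φ) ∈ A ↔ φ ∈ Set.Ioo (-θ) θ ∧ g φ ≤ ρ ∧ ρ < r)) :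
    MeasureTheory.volume A = ENNReal.ofReal (∫ φ in (-θ)..θ, (r ^ 2 - g φ ^ 2) / 2) := by
  have h1 : MeasureTheory.volume A = ∫⁻ z : ℂ, A.indicator 1 z := by
    rw [MeasureTheory.lintegral_indicator_one hA]
  set B : Set (ℝ × ℝ) := {p | 0 < p.1 ∧ p.2 ∈ Set.Ioo (-θ) θ ∧ g p.2 ≤ p.1 ∧ p.1 < r} with hB
  have hBm : MeasurableSet B := by
    refine (measurableSet_lt measurable_const measurable_fst).inter 
      ((measurable_snd measurableSet_Ioo).inter 
      ((measurableSet_le (hg.comp measurable_snd) measurable_fst).inter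
        (measurableSet_lt measurable_fst measurable_const)))
  rw [h1, ← Complex.lintegral_comp_polarCoord_symm,
    ← MeasureTheory.lintegral_indicator (polarCoord.open_target.measurableSet)]
  have h2 : ∀ p : ℝ × ℝ, polarCoord.target.indicator (fun p ↦ ENNReal.ofReal p.1 • A.indicator (1 : ℂ → ENNReal) (Complex.polarCoord.symm p)) p = B.indicator (fun p ↦ ENNReal.ofReal p.1) p := by
    rintro ⟨ρ, φ⟩
    by_cases hp : (ρ, φ) ∈ polarCoord.target
    · rw [Set.indicator_of_mem hp]
      have hp' : 0 < ρ ∧ φ ∈ Set.Ioo (-π) π := by simpa [polarCoord_target] using hp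
      by_cases hq : Complex.polarCoord.symm (ρ, φ) ∈ A
      · rw [Set.indicator_of_mem hq, Set.indicator_of_mem]
        · simp
        · exact ⟨hp'.1, (hAm ρ φ hp'.1 hp'.2).1 hq⟩
      · rw [Set.indicator_of_notMem hq, Set.indicator_of_notMem]
        · simp
        · intro h
          exact hq ((hAm ρ φ hp'.1 hp'.2).2 h.2)
    · rw [Set.indicator_of_notMem hp, Set.indicator_of_notMem]
      intro h
      apply hp
      rw [polarCoord_target]
      exact ⟨h.1, by linarith [h.2.1.1], by linarith [h.2.1.2]⟩
  simp_rw [h2]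
  rw [MeasureTheory.Measure.volume_eq_prod, MeasureTheory.lintegral_prod_symm]
  swap
  · exact ((ENNReal.measurable_ofReal.comp measurable_fst).indicator hBm).aemeasurable
  have h3 : ∀ φ : ℝ, ∫⁻ ρ : ℝ, B.indicator (fun p ↦ ENNReal.ofReal p.1) (ρ, φ) =
      (Set.Ioo (-θ) θ).indicator (fun φ ↦ ENNReal.ofReal ((r ^ 2 - g φ ^ 2) / 2)) φ := by
    intro φ
    by_cases hφ : φ ∈ Set.Ioo (-θ) θ
    · rw [Set.indicator_of_mem hφ, ← inner_radial (g φ) r (hg0 φ hφ) (hgr φ hφ),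
        ← MeasureTheory.lintegral_indicator measurableSet_Ico]
      congr 1
      ext ρ
      by_cases hρ : ρ ∈ Set.Ico (g φ) r
      · rw [Set.indicator_of_mem hρ]
        rcases ((hg0 φ hφ).trans hρ.1).eq_or_lt with h0 | h0
        · rw [← h0]
          by_cases hh : ((0 : ℝ), φ) ∈ B
          · rw [Set.indicator_of_mem hh]
          · rw [Set.indicator_of_notMem hh]; simp
        · rw [Set.indicator_of_mem]
          exact ⟨h0, hφ, hρ.1, hρ.2⟩
      · rw [Set.indicator_of_notMem hρ, Set.indicator_of_notMem]
        intro h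
        exact hρ h.2.2
    · rw [Set.indicator_of_notMem hφ]
      rw [MeasureTheory.lintegral_eq_zero_of_ae_eq_zero]
      filter_upwards with ρ
      rw [Set.indicator_of_notMem]
      · rfl
      · intro h
        exact hφ h.2.1
  simp_rw [h3]
  rw [MeasureTheory.lintegral_indicator measurableSet_Ioo, 
    ← MeasureTheory.ofReal_integral_eq_lintegral_ofReal,
    intervalIntegral.integral_of_le (by linarith), MeasureTheory.integral_Ioc_eq_integral_Ioo]
  · refine MeasureTheory.IntegrableOn.mono_set (t := Set.Icc (-θ) θ) ?_ Set.Ioo_subset_Icc_self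
    apply ContinuousOn.integrableOn_Icc
    fun_prop
  · filter_upwards [MeasureTheory.ae_restrict_mem measurableSet_Ioo] with t ht
    have := hg0 t ht
    have := hgr t ht
    simp only [Pi.zero_apply]
    nlinarith

lemma cos_gt_iff (θ φ : ℝ) (hθ : 0 ≤ θ) (hθ' : θ ≤ π) (hφ : φ ∈ Set.Ioo (-π) π) :
    Real.cos θ < Real.cos φ ↔ φ ∈ Set.Ioo (-θ) θ := by
  rw [← Real.cos_abs φ, Real.strictAntiOn_cos.lt_iff_gt ⟨hθ, hθ'⟩ 
    ⟨abs_nonneg _, (abs_lt.2 hφ).le⟩, abs_lt]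
  rfl

lemma sector_volume (r θ : ℝ) (hr : 0 < r) (hθ : 0 ≤ θ) (hθ' : θ ≤ π) :
    MeasureTheory.volume {z : ℂ | ‖z‖ < r ∧ Real.cos θ * ‖z‖ < z.re} = ENNReal.ofReal (r ^ 2 * θ) := by
  rw [polar_volume _ _ (fun _ ↦ 0) measurable_const θ r hθ hθ' continuousOn_const]
  · congr 1
    simp
    ring
  · simp
  · intro _ _
    exact hr.le
  · intro ρ φ hρ hφ
    rw [← cos_gt_iff θ φ hθ hθ' hφ]
    simp only [Set.mem_ofPred_eq, Complex.norm_polarCoord_symm, abs_of_pos hρ]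
    rw [Complex.polarCoord_symm_apply]
    have : ((ρ:ℂ) * (((Real.cos φ : ℝ) : ℂ) + ((Real.sin φ : ℝ) : ℂ) * Complex.I)).re = ρ * Real.cos φ := by
      rw [Complex.re_ofReal_mul]
      congr 1
      simp [-Complex.ofReal_cos, -Complex.ofReal_sin]
    rw [this, mul_comm, mul_lt_mul_iff_right₀ hρ]
    have := hρ.le
    tauto
  · exact MeasurableSet.inter (s₁ := {z : ℂ | ‖z‖ < r}) (s₂ := {z : ℂ | Real.cos θ * ‖z‖ < z.re})
      (measurableSet_lt (by fun_prop) (by fun_prop)) (measurableSet_lt (by fun_prop) (by fun_prop))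

lemma segment_volume (r θ : ℝ) (hr : 0 < r) (hθ : 0 ≤ θ) (hθ' : θ < π / 2) :
    MeasureTheory.volume {z : ℂ | ‖z‖ < r ∧ r * Real.cos θ ≤ z.re} = 
      ENNReal.ofReal (r ^ 2 * (θ - Real.sin θ * Real.cos θ)) := by
  have hπ := Real.pi_pos
  have hcθ : 0 < Real.cos θ := Real.cos_pos_of_mem_Ioo ⟨by linarith, hθ'⟩
  have hc : ∀ φ ∈ Set.Icc (-θ) θ, Real.cos θ ≤ Real.cos φ := by
    intro φ hφ
    rw [← Real.cos_abs φ]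
    exact Real.cos_le_cos_of_nonneg_of_le_pi (abs_nonneg _) (by linarith) (abs_le.2 hφ)
  rw [polar_volume _ _ (fun φ ↦ r * Real.cos θ / Real.cos φ) (by fun_prop) θ r hθ (by linarith)]
  · congr 1
    have : ∫ φ in (-θ)..θ, (r ^ 2 - (r * Real.cos θ / Real.cos φ) ^ 2) / 2 = 
        (r ^ 2 * θ - (r * Real.cos θ) ^ 2 * Real.tan θ) / 2 - (r ^ 2 * (-θ) - (r * Real.cos θ) ^ 2 * Real.tan (-θ)) / 2 := by
      apply intervalIntegral.integral_eq_sub_of_hasDerivAt (f := fun φ ↦ (r ^ 2 * φ - (r * Real.cos θ) ^ 2 * Real.tan φ) / 2)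
      · intro φ hφ
        rw [Set.uIcc_of_le (by linarith)] at hφ
        have h0 : Real.cos φ ≠ 0 := by have := hc φ hφ; linarith
        have hD := (((hasDerivAt_id φ).const_mul (r^2)).sub
          ((Real.hasDerivAt_tan h0).const_mul ((r * Real.cos θ) ^ 2))).div_const 2
        have e : (r ^ 2 * 1 - (r * Real.cos θ) ^ 2 * (1 / Real.cos φ ^ 2)) / 2 =
            (r ^ 2 - (r * Real.cos θ / Real.cos φ) ^ 2) / 2 := by
          rw [div_pow]
          ring
        rw [e] at hD
        exact hD
      · apply ContinuousOn.intervalIntegrable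
        rw [Set.uIcc_of_le (by linarith)]
        have : ∀ φ ∈ Set.Icc (-θ) θ, Real.cos φ ≠ 0 := fun φ hφ ↦ by have := hc φ hφ; linarith
        fun_prop (disch := assumption)
    rw [this, Real.tan_neg, Real.tan_eq_sin_div_cos]
    field_simp
    ring
  · have : ∀ φ ∈ Set.Icc (-θ) θ, Real.cos φ ≠ 0 := fun φ hφ ↦ by have := hc φ hφ; linarith
    fun_prop (disch := assumption)
  · intro φ hφ
    have := hc φ (Set.Ioo_subset_Icc_self hφ)
    have : 0 < Real.cos φ := by linarith
    positivity
  · intro φ hφ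
    have := hc φ (Set.Ioo_subset_Icc_self hφ)
    rw [div_le_iff₀ (by linarith)]
    nlinarith
  · intro ρ φ hρ hφ
    rw [← cos_gt_iff θ φ hθ (by linarith) hφ]
    simp only [Set.mem_ofPred_eq, Complex.norm_polarCoord_symm, abs_of_pos hρ]
    rw [Complex.polarCoord_symm_apply]
    have : ((ρ:ℂ) * (((Real.cos φ : ℝ) : ℂ) + ((Real.sin φ : ℝ) : ℂ) * Complex.I)).re = ρ * Real.cos φ := by
      rw [Complex.re_ofReal_mul]
      congr 1
      simp [-Complex.ofReal_cos, -Complex.ofReal_sin]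
    rw [this]
    constructor
    · rintro ⟨h1, h2⟩
      have h3 : 0 < Real.cos φ := by
        by_contra h
        have : 0 < r * Real.cos θ := by positivity
        nlinarith
      refine ⟨?_, ?_, h1⟩
      · nlinarith
      · rwa [div_le_iff₀ h3]
    · rintro ⟨h1, h2, h3⟩
      rw [div_le_iff₀ (by linarith)] at h2
      exact ⟨h3, h2⟩
  · exact MeasurableSet.inter (s₁ := {z : ℂ | ‖z‖ < r}) (s₂ := {z : ℂ | r * Real.cos θ ≤ z.re})
      (measurableSet_lt (by fun_prop) (by fun_prop)) (measurableSet_le (by fun_prop) (by fun_prop))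

lemma sin_mul_cos_ge (θ : ℝ) (h0 : 0 ≤ θ) (h : θ ≤ π / 6) :
    3 * √3 / (2 * π) * θ ≤ Real.sin θ * Real.cos θ := by
  have hπ := Real.pi_pos
  have hx : (0 : ℝ) ∈ Set.Icc 0 π := ⟨le_rfl, hπ.le⟩
  have hy : π / 3 ∈ Set.Icc 0 π := ⟨by linarith, by linarith⟩
  have ha : 0 ≤ 1 - 6 * θ / π := by rw [sub_nonneg, div_le_one hπ]; linarith
  have hb : 0 ≤ 6 * θ / π := by positivity
  have hc := strictConcaveOn_sin_Icc.concaveOn.2 hx hy ha hb (by ring)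
  simp only [smul_eq_mul, mul_zero, Real.sin_zero, zero_add, Real.sin_pi_div_three] at hc
  have : 6 * θ / π * (π / 3) = 2 * θ := by field_simp; ring
  rw [this, Real.sin_two_mul] at hc
  have : 6 * θ / π * (√3 / 2) = 2 * (3 * √3 / (2 * π) * θ) := by field_simp; ring
  linarith

/-- key comparison -/
lemma segment_le_sector (r d : ℝ) (hr : 0 < r) (hd : r * (√3 / 2) ≤ d) :
    MeasureTheory.volume {z : ℂ | ‖z‖ < r ∧ d ≤ z.re} ≤ 
      ENNReal.ofReal (1 - 3 * √3 / (2 * π)) * 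
        MeasureTheory.volume {z : ℂ | ‖z‖ < r ∧ d * ‖z‖ < r * z.re} := by
  have hπ := Real.pi_pos
  rcases le_or_gt r d with h | h
  · have : {z : ℂ | ‖z‖ < r ∧ d ≤ z.re} = ∅ := by
      ext z
      simp only [Set.mem_ofPred_eq, Set.mem_empty_iff_false, iff_false]
      rintro ⟨h1, h2⟩
      have := Complex.re_le_norm z
      linarith
    rw [this]; simp
  · set θ := Real.arccos (d / r) with hθ
    have h3 : 0 < √3 := by positivity
    have hd0 : 0 < d := lt_of_lt_of_le (by positivity) hd
    have hcos : Real.cos θ = d / r := Real.cos_arccos (by linarith [div_pos hd0 hr]) (by rw [div_le_one hr]; linarith)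
    have h0 : 0 ≤ θ := Real.arccos_nonneg _
    have hθ6 : θ ≤ π / 6 := by
      have : Real.arccos (Real.cos (π / 6)) = π / 6 := Real.arccos_cos (by linarith) (by linarith)
      rw [← this, Real.cos_pi_div_six]
      apply Real.arccos_le_arccos
      rw [le_div_iff₀ hr]; linarith
    have e1 : {z : ℂ | ‖z‖ < r ∧ d ≤ z.re} = {z : ℂ | ‖z‖ < r ∧ r * Real.cos θ ≤ z.re} := by
      rw [hcos, mul_div_cancel₀ _ hr.ne']
    have e2 : {z : ℂ | ‖z‖ < r ∧ d * ‖z‖ < r * z.re} = {z : ℂ | ‖z‖ < r ∧ Real.cos θ * ‖z‖ < z.re} := by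
      ext z
      simp only [Set.mem_ofPred_eq, hcos]
      rw [div_mul_eq_mul_div, div_lt_iff₀ hr, mul_comm r]
    rw [e1, e2, segment_volume r θ hr h0 (by linarith), sector_volume r θ hr h0 (by linarith),
      ← ENNReal.ofReal_mul']
    · apply ENNReal.ofReal_le_ofReal
      have := sin_mul_cos_ge θ h0 hθ6
      nlinarith [sq_nonneg r]
    · positivity

lemma seg_le_sec (r : ℝ) (w : ℂ) (hr : 0 < r) (hw : r * √3 ≤ ‖w‖) :
    MeasureTheory.volume {z : ℂ | ‖z‖ < r ∧ ‖z - w‖ ≤ ‖z‖} ≤ 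
      ENNReal.ofReal (1 - 3 * √3 / (2 * π)) * 
        MeasureTheory.volume {z : ℂ | ‖z‖ < r ∧
          ‖w‖ / 2 * ‖w‖ * ‖z‖ < r * (w.re * z.re + w.im * z.im)} := by
  have hw0 : 0 < ‖w‖ := lt_of_lt_of_le (by positivity) hw
  have hwc : (‖w‖ : ℂ) ≠ 0 := by exact_mod_cast hw0.ne'
  have hu : ‖w / ‖w‖‖ = 1 := by simp [hw0.ne']
  let U : Circle := ⟨w / ‖w‖, by simp [Submonoid.unitSphere, hw0.ne']⟩
  have hUv : (U : ℂ) = w / ‖w‖ := rfl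
  have hU : MeasureTheory.MeasurePreserving (rotation U) := (rotation U).measurePreserving
  have hn : ∀ z, ‖rotation U z‖ = ‖z‖ := fun z ↦ (rotation U).norm_map z
  have hre : ∀ z, w.re * (rotation U z).re + w.im * (rotation U z).im = ‖w‖ * z.re := by
    intro z
    have hs : ‖w‖ ^ 2 = w.re ^ 2 + w.im ^ 2 := by
      rw [← Complex.normSq_eq_norm_sq, Complex.normSq_apply]; ring
    rw [rotation_apply, hUv, Complex.mul_re, Complex.mul_im, Complex.div_ofReal_re, Complex.div_ofReal_im]
    field_simp
    rw [hs]
    ring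
  have e1 : (rotation U) ⁻¹' {z : ℂ | ‖z‖ < r ∧ ‖z - w‖ ≤ ‖z‖} = {z : ℂ | ‖z‖ < r ∧ ‖w‖ / 2 ≤ z.re} := by
    ext z
    simp only [Set.mem_preimage, Set.mem_ofPred_eq, hn]
    refine and_congr_right fun _ ↦ ?_
    rw [← hn z, ← sq_le_sq₀ (norm_nonneg _) (norm_nonneg _), ← Complex.normSq_eq_norm_sq,
      ← Complex.normSq_eq_norm_sq, Complex.normSq_apply, Complex.normSq_apply, Complex.sub_re, Complex.sub_im]
    have hs : ‖w‖ ^ 2 = w.re ^ 2 + w.im ^ 2 := by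
      rw [← Complex.normSq_eq_norm_sq, Complex.normSq_apply]; ring
    have h1 := hre z
    constructor
    · intro h
      have : ‖w‖ * (‖w‖ / 2) ≤ ‖w‖ * z.re := by nlinarith
      exact le_of_mul_le_mul_left this hw0
    · intro h
      have : ‖w‖ * (‖w‖ / 2) ≤ ‖w‖ * z.re := mul_le_mul_of_nonneg_left h hw0.le
      nlinarith
  have e2 : (rotation U) ⁻¹' {z : ℂ | ‖z‖ < r ∧
          ‖w‖ / 2 * ‖w‖ * ‖z‖ < r * (w.re * z.re + w.im * z.im)} = {z : ℂ | ‖z‖ < r ∧ ‖w‖ / 2 * ‖z‖ < r * z.re} := by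
    ext z
    simp only [Set.mem_preimage, Set.mem_ofPred_eq, hn, hre]
    refine and_congr_right fun _ ↦ ?_
    rw [← mul_lt_mul_iff_right₀ hw0 (b := ‖w‖ / 2 * ‖z‖)]
    ring_nf
  have hemb : MeasurableEmbedding (rotation U) :=
    (rotation U).toHomeomorph.measurableEmbedding
  rw [← hU.measure_preimage_emb hemb {z : ℂ | ‖z‖ < r ∧ ‖z - w‖ ≤ ‖z‖}, e1,
    ← hU.measure_preimage_emb hemb {z : ℂ | ‖z‖ < r ∧
      ‖w‖ / 2 * ‖w‖ * ‖z‖ < r * (w.re * z.re + w.im * z.im)}, e2]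
  exact segment_le_sector r (‖w‖ / 2) hr (by linarith)

lemma sec_disj (r : ℝ) (hr : 0 < r) (hr2 : r ^ 2 = 4 / 3) (v w : ℂ) (hv : 2 ≤ ‖v‖) (hw : 2 ≤ ‖w‖)
    (hvw : 2 ≤ ‖v - w‖) :
    Disjoint {z : ℂ | ‖z‖ < r ∧ ‖v‖ / 2 * ‖v‖ * ‖z‖ < r * (v.re * z.re + v.im * z.im)}
      {z : ℂ | ‖z‖ < r ∧ ‖w‖ / 2 * ‖w‖ * ‖z‖ < r * (w.re * z.re + w.im * z.im)} := by
  rw [Set.disjoint_left]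
  rintro z ⟨h1, h2⟩ ⟨-, h3⟩
  have hz : 0 < ‖z‖ := by
    rw [norm_pos_iff]
    rintro rfl
    simp at h2
  have hsv : ‖v‖ ^ 2 = v.re ^ 2 + v.im ^ 2 := by
    rw [← Complex.normSq_eq_norm_sq, Complex.normSq_apply]; ring
  have hsw : ‖w‖ ^ 2 = w.re ^ 2 + w.im ^ 2 := by
    rw [← Complex.normSq_eq_norm_sq, Complex.normSq_apply]; ring
  have hsz : ‖z‖ ^ 2 = z.re ^ 2 + z.im ^ 2 := by
    rw [← Complex.normSq_eq_norm_sq, Complex.normSq_apply]; ring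
  have hsvw : ‖v - w‖ ^ 2 = (v.re - w.re) ^ 2 + (v.im - w.im) ^ 2 := by
    rw [← Complex.normSq_eq_norm_sq, Complex.normSq_apply, Complex.sub_re, Complex.sub_im]; ring
  obtain ⟨a, ha⟩ : ∃ a, a = r / ‖z‖ * z.re := ⟨_, rfl⟩
  obtain ⟨b, hb⟩ : ∃ b, b = r / ‖z‖ * z.im := ⟨_, rfl⟩
  have hab : a ^ 2 + b ^ 2 = r ^ 2 := by
    rw [ha, hb, mul_pow, mul_pow, ← mul_add, ← hsz]
    field_simp
  have h2' : ‖v‖ ^ 2 / 2 < v.re * a + v.im * b := by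
    have : v.re * a + v.im * b = (r * (v.re * z.re + v.im * z.im)) / ‖z‖ := by
      rw [ha, hb]; ring
    rw [this, lt_div_iff₀ hz]
    linarith
  have h3' : ‖w‖ ^ 2 / 2 < w.re * a + w.im * b := by
    have : w.re * a + w.im * b = (r * (w.re * z.re + w.im * z.im)) / ‖z‖ := by
      rw [ha, hb]; ring
    rw [this, lt_div_iff₀ hz]
    linarith
  have q1 : 4 ≤ ‖v‖ ^ 2 := by nlinarith
  have q2 : 4 ≤ ‖w‖ ^ 2 := by nlinarith
  have q3 : 4 ≤ ‖v - w‖ ^ 2 := by nlinarith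
  rw [hsv] at *
  rw [hsw] at *
  rw [hsvw] at *
  nlinarith [sq_nonneg (3 * a - v.re - w.re), sq_nonneg (3 * b - v.im - w.im)]

lemma cell_volume_s6 {ι : Type*} (T : Finset ι) (w : ι → ℂ) (r : ℝ) (hr : 0 < r) (hr2 : r ^ 2 = 4 / 3)
    (hw : ∀ i ∈ T, 2 ≤ ‖w i‖) (hww : ∀ i ∈ T, ∀ j ∈ T, i ≠ j → 2 ≤ ‖w i - w j‖) :
    ENNReal.ofReal (2 * √3) ≤ 
      MeasureTheory.volume {z : ℂ | ‖z‖ < r ∧ ∀ i ∈ T, ‖z‖ < ‖z - w i‖} := by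
  have hπ := Real.pi_pos
  have hπ3 := Real.pi_gt_three
  have h3 : √3 ^ 2 = 3 := Real.sq_sqrt (by norm_num)
  have h30 : 0 < √3 := by positivity
  have hr3 : r * √3 = 2 := by
    have : (r * √3) ^ 2 = 2 ^ 2 := by rw [mul_pow, hr2, h3]; norm_num
    exact (sq_eq_sq₀ (by positivity) (by norm_num)).1 this
  set V := {z : ℂ | ‖z‖ < r ∧ ∀ i ∈ T, ‖z‖ < ‖z - w i‖} with hV
  set c := ENNReal.ofReal (1 - 3 * √3 / (2 * π)) with hc
  have hc0 : 0 ≤ 1 - 3 * √3 / (2 * π) := by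
    rw [sub_nonneg, div_le_one (by positivity)]
    nlinarith
  let sec : ι → Set ℂ := fun i ↦ {z : ℂ | ‖z‖ < r ∧
          ‖w i‖ / 2 * ‖w i‖ * ‖z‖ < r * ((w i).re * z.re + (w i).im * z.im)}
  have hball : MeasureTheory.volume (ball (0 : ℂ) r) = ENNReal.ofReal (π * (4 / 3)) := by
    rw [Complex.volume_ball, ← hr2, mul_comm, ENNReal.ofReal_mul hπ.le, ENNReal.ofReal_pow hr.le]
    congr 1
    rw [ENNReal.ofReal, Real.toNNReal_of_nonneg hπ.le]
    rfl
  have hsub : ball (0 : ℂ) r ⊆ V ∪ ⋃ i ∈ T, {z : ℂ | ‖z‖ < r ∧ ‖z - w i‖ ≤ ‖z‖} := by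
    intro z hz
    have hz' : ‖z‖ < r := by simpa using hz
    by_cases h : z ∈ V
    · exact Or.inl h
    · right
      have : ∃ i ∈ T, ‖z - w i‖ ≤ ‖z‖ := by
        by_contra! hcon
        exact h ⟨hz', hcon⟩
      obtain ⟨i, hi, hi'⟩ := this
      exact Set.mem_biUnion hi ⟨hz', hi'⟩
  have hsec : ∑ i ∈ T, MeasureTheory.volume (sec i) ≤ MeasureTheory.volume (ball (0 : ℂ) r) := by
    rw [← MeasureTheory.measure_biUnion_finset]
    · apply MeasureTheory.measure_mono
      intro z hz
      simp only [Set.mem_iUnion] at hz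
      obtain ⟨i, hi, hz⟩ := hz
      simpa using hz.1
    · intro i hi j hj hij
      exact sec_disj r hr hr2 _ _ (hw i hi) (hw j hj) (hww i hi j hj hij)
    · intro i hi
      exact MeasurableSet.inter (s₁ := {z : ℂ | ‖z‖ < r}) 
        (s₂ := {z : ℂ | ‖w i‖ / 2 * ‖w i‖ * ‖z‖ < r * ((w i).re * z.re + (w i).im * z.im)})
        (measurableSet_lt (by fun_prop) (by fun_prop)) (measurableSet_lt (by fun_prop) (by fun_prop))
  have hmain : MeasureTheory.volume (ball (0 : ℂ) r) ≤ 
      MeasureTheory.volume V + c * MeasureTheory.volume (ball (0 : ℂ) r) := by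
    calc MeasureTheory.volume (ball (0 : ℂ) r) ≤ _ := MeasureTheory.measure_mono hsub
      _ ≤ _ := MeasureTheory.measure_union_le _ _
      _ ≤ MeasureTheory.volume V + ∑ i ∈ T, MeasureTheory.volume {z : ℂ | ‖z‖ < r ∧ ‖z - w i‖ ≤ ‖z‖} := by
        gcongr
        exact MeasureTheory.measure_biUnion_finset_le _ _
      _ ≤ MeasureTheory.volume V + ∑ i ∈ T, c * MeasureTheory.volume (sec i) := by
        gcongr with i hi
        exact seg_le_sec r (w i) hr (by rw [hr3]; exact hw i hi)
      _ ≤ _ := by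
        rw [← Finset.mul_sum]
        gcongr
  rw [hball, hc, ← ENNReal.ofReal_mul hc0] at hmain
  have he : ENNReal.ofReal (2 * √3) = ENNReal.ofReal (π * (4 / 3)) - 
      ENNReal.ofReal ((1 - 3 * √3 / (2 * π)) * (π * (4 / 3))) := by
    rw [← ENNReal.ofReal_sub _ (by positivity)]
    congr 1
    field_simp
    ring
  rw [he]
  exact tsub_le_iff_right.2 hmain

lemma packing_bound {ι : Type*} [Fintype ι] (f : ι → ℂ) (L : ℝ) (hL : 0 ≤ L)
    (hf : ∀ i j, i ≠ j → 2 ≤ ‖f i - f j‖)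
    (hre : ∀ i, (f i).re ∈ Set.Icc 0 L) (him : ∀ i, (f i).im ∈ Set.Icc 0 L) :
    (Fintype.card ι : ℝ) * (2 * √3) ≤ (L + 4) ^ 2 := by
  classical
  obtain ⟨r, hr⟩ : ∃ r, r = √(4 / 3 : ℝ) := ⟨_, rfl⟩
  have hr0 : 0 < r := by rw [hr]; positivity
  have hr2 : r ^ 2 = 4 / 3 := by rw [hr]; exact Real.sq_sqrt (by norm_num)
  have hr4 : r ≤ 2 := by nlinarith
  let V : ι → Set ℂ := fun i ↦ {z : ℂ | ‖z - f i‖ < r ∧ ∀ j ∈ Finset.univ.erase i, ‖z - f i‖ < ‖z - f j‖}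
  have hVv : ∀ i, ENNReal.ofReal (2 * √3) ≤ MeasureTheory.volume (V i) := by
    intro i
    have h1 := cell_volume_s6 (Finset.univ.erase i) (fun j ↦ f j - f i) r hr0 hr2 
      (fun j hj ↦ hf j i (Finset.ne_of_mem_erase hj)) 
      (fun j _ l _ hjl ↦ by simpa using hf j l hjl)
    rw [← MeasureTheory.measure_preimage_add_right _ (-f i)] at h1
    convert h1 using 2
    ext z
    simp only [V, Set.mem_preimage, Set.mem_ofPred_eq, ← sub_eq_add_neg, sub_sub_sub_cancel_right]
  have hVm : ∀ i, MeasurableSet (V i) := by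
    intro i
    have : V i = {z : ℂ | ‖z - f i‖ < r} ∩ ⋂ j ∈ Finset.univ.erase i, {z : ℂ | ‖z - f i‖ < ‖z - f j‖} := by
      ext z
      simp [V]
    rw [this]
    refine (measurableSet_lt (by fun_prop) (by fun_prop)).inter ?_
    refine Finset.measurableSet_biInter _ fun j _ ↦ (measurableSet_lt (by fun_prop) (by fun_prop))
  have hVd : Pairwise (Function.onFun Disjoint V) := by
    intro i j hij
    rw [Function.onFun, Set.disjoint_left]
    rintro z ⟨-, h1⟩ ⟨-, h2⟩
    have h1 := h1 j (by simp [hij.symm])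
    have h2 := h2 i (by simp [hij])
    linarith
  have hVs : (⋃ i, V i) ⊆ Complex.measurableEquivRealProd ⁻¹' (Set.Icc (-2) (L + 2) ×ˢ Set.Icc (-2) (L + 2)) := by
    intro z hz
    obtain ⟨i, hi⟩ := Set.mem_iUnion.1 hz
    have h1 := abs_le.1 ((Complex.abs_re_le_norm (z - f i)).trans (hi.1.le.trans hr4))
    have h2 := abs_le.1 ((Complex.abs_im_le_norm (z - f i)).trans (hi.1.le.trans hr4))
    rw [Complex.sub_re] at h1
    rw [Complex.sub_im] at h2
    have := hre i
    have := him i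
    simp only [Set.mem_Icc] at *
    simp only [Set.mem_preimage, Complex.measurableEquivRealProd_apply, Set.mem_prod, Set.mem_Icc]
    refine ⟨⟨?_, ?_⟩, ?_, ?_⟩ <;> linarith
  have hfin : (Fintype.card ι : ENNReal) * ENNReal.ofReal (2 * √3) ≤ ENNReal.ofReal ((L + 4) ^ 2) := by
    calc (Fintype.card ι : ENNReal) * ENNReal.ofReal (2 * √3) = ∑ i : ι, ENNReal.ofReal (2 * √3) := by simp
      _ ≤ ∑ i, MeasureTheory.volume (V i) := Finset.sum_le_sum fun i _ ↦ hVv i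
      _ = MeasureTheory.volume (⋃ i, V i) := by
        rw [MeasureTheory.measure_iUnion hVd hVm, tsum_fintype]
      _ ≤ _ := MeasureTheory.measure_mono hVs
      _ = _ := by
        rw [Complex.volume_preserving_equiv_real_prod.measure_preimage_equiv, 
          MeasureTheory.Measure.volume_eq_prod, MeasureTheory.Measure.prod_prod, Real.volume_Icc,
          ← ENNReal.ofReal_mul (by linarith)]
        congr 1
        ring
  rw [← ENNReal.ofReal_natCast, ← ENNReal.ofReal_mul (by positivity), ENNReal.ofReal_le_ofReal_iff (by positivity)] at hfin
  exact hfin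

lemma tiled_bound (k N : ℕ) (x : ℝ) (hx : 0 < x) (p : Fin k → EuclideanSpace ℝ (Fin 2))
    (hsq : ∀ i, ∀ j : Fin 2, p i j ∈ Set.Icc (0 : ℝ) 1)
    (hdist : ∀ i j, i ≠ j → 2 * x ≤ dist (p i) (p j)) :
    ((N : ℝ) ^ 2 * k) * (2 * √3) ≤ (N * (1 / x + 2) + 4) ^ 2 := by
  set s := 1 / x + 2 with hs
  have hx1 : 0 < 1 / x := by positivity
  let f : Fin N × Fin N × Fin k → ℂ := fun t ↦ ⟨p t.2.2 0 / x + (t.1 : ℕ) * s, p t.2.2 1 / x + (t.2.1 : ℕ) * s⟩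
  have hb : ∀ i j, 0 ≤ p i j / x ∧ p i j / x ≤ 1 / x := by
    intro i j
    have := hsq i j
    exact ⟨div_nonneg this.1 hx.le, by gcongr; exact this.2⟩
  have hL : ∀ (a : Fin N) (i) (j), p i j / x + (a : ℕ) * s ∈ Set.Icc 0 (N * s) := by
    intro a i j
    have h1 := hb i j
    have h2 : ((a : ℕ) : ℝ) + 1 ≤ N := by exact_mod_cast a.2
    have h3 : (0 : ℝ) ≤ (a : ℕ) := by positivity
    constructor
    · have : 0 ≤ s := by linarith
      have := mul_nonneg h3 this
      linarith
    · nlinarith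
  have hsep : ∀ (a b : Fin N) (u v : ℝ), a ≠ b → 0 ≤ u → u ≤ 1 / x → 0 ≤ v → v ≤ 1 / x → 
      2 ≤ |(u + (a : ℕ) * s) - (v + (b : ℕ) * s)| := by
    intro a b u v hab hu hu' hv hv'
    rcases lt_or_gt_of_ne hab with h | h
    · have h2 : ((a : ℕ) : ℝ) + 1 ≤ (b : ℕ) := by exact_mod_cast h
      rw [abs_sub_comm]
      refine le_trans ?_ (le_abs_self _)
      nlinarith
    · have h2 : ((b : ℕ) : ℝ) + 1 ≤ (a : ℕ) := by exact_mod_cast h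
      refine le_trans ?_ (le_abs_self _)
      nlinarith
  have key := packing_bound f (N * s) (by positivity) ?_ (fun t ↦ hL _ _ _) (fun t ↦ hL _ _ _)
  · simp only [Fintype.card_prod, Fintype.card_fin] at key
    push_cast at key
    linarith
  · rintro ⟨a, b, i⟩ ⟨a', b', i'⟩ hne
    by_cases h1 : a = a'
    · by_cases h2 : b = b'
      · subst h1 h2
        have hi : i ≠ i' := fun h ↦ hne (by rw [h])
        have hd := hdist i i' hi
        rw [EuclideanSpace.dist_eq, Fin.sum_univ_two, Real.dist_eq, Real.dist_eq, sq_abs, sq_abs] at hd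
        rw [Complex.norm_def]
        apply Real.le_sqrt_of_sq_le
        have hd2 := (Real.le_sqrt' (by positivity)).1 hd
        rw [Complex.normSq_apply]
        simp only [f, Complex.sub_re, Complex.sub_im]
        have : (2 : ℝ) ^ 2 = (2 * x) ^ 2 / x ^ 2 := by field_simp
        rw [this, div_le_iff₀ (by positivity)]
        refine hd2.trans (le_of_eq ?_)
        field_simp
        ring
      · exact (hsep b b' _ _ h2 (hb i 1).1 (hb i 1).2 (hb i' 1).1 (hb i' 1).2).trans 
          (Complex.abs_im_le_norm (f (a, b, i) - f (a', b', i')))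
    · exact (hsep a a' _ _ h1 (hb i 0).1 (hb i 0).2 (hb i' 0).1 (hb i' 0).2).trans 
          (Complex.abs_re_le_norm (f (a, b, i) - f (a', b', i')))

theorem dispersion_upper_bound_random_square
    (k : ℕ) (hk : 3 * 10 ^ 5 ≤ k)
    (x : ℝ) (hx : 0 < x) (p : Fin k → EuclideanSpace ℝ (Fin 2))
    (hinj : Function.Injective p)
    (hsq : ∀ i, ∀ j : Fin 2, p i j ∈ Set.Icc (0 : ℝ) 1)
    (hdist : ∀ i j, i ≠ j → 2 * x ≤ dist (p i) (p j)) :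
    x ≤ 1 / ((12 : ℝ) ^ ((1 : ℝ) / 4) * Real.sqrt k - 2) ∧
      1 / ((12 : ℝ) ^ ((1 : ℝ) / 4) * Real.sqrt k - 2) ≤
        1.002 / ((12 : ℝ) ^ ((1 : ℝ) / 4) * Real.sqrt k) ∧
      2 * x ≤ (2 * 1.002) / ((12 : ℝ) ^ ((1 : ℝ) / 4) * Real.sqrt k) := by
  obtain ⟨c, hc⟩ : ∃ c, c = (12 : ℝ) ^ ((1 : ℝ) / 4) * Real.sqrt k := ⟨_, rfl⟩
  have hc0 : 0 ≤ c := by rw [hc]; positivity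
  have h30 : 0 < √3 := by positivity
  have h3 : √3 ^ 2 = 3 := Real.sq_sqrt (by norm_num)
  have h12 : ((12 : ℝ) ^ ((1 : ℝ) / 4)) ^ 2 = 2 * √3 := by
    have h4 : (((12 : ℝ) ^ ((1 : ℝ) / 4)) ^ 2) ^ 2 = 12 := by
      rw [← pow_mul, ← Real.rpow_natCast, ← Real.rpow_mul (by norm_num)]
      norm_num
    have : (2 * √3) ^ 2 = 12 := by rw [mul_pow, h3]; norm_num
    exact (sq_eq_sq₀ (by positivity) (by positivity)).1 (h4.trans this.symm)
  have hc2 : c ^ 2 = k * (2 * √3) := by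
    rw [hc, mul_pow, h12, Real.sq_sqrt (by positivity)]
    ring
  have hk' : (3 * 10 ^ 5 : ℝ) ≤ k := by exact_mod_cast hk
  have hc1 : 1002 ≤ c := by
    have : 1.7 < √3 := by rw [Real.lt_sqrt (by norm_num)]; norm_num
    nlinarith
  have hbound : c ≤ 1 / x + 2 := by
    by_contra! hcon
    obtain ⟨N, hN⟩ := exists_nat_gt (4 / (c - (1 / x + 2)))
    rw [div_lt_iff₀ (by linarith)] at hN
    have h := tiled_bound k N x hx p hsq hdist
    have h' : (N * c) ^ 2 ≤ (N * (1 / x + 2) + 4) ^ 2 := by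
      rw [mul_pow, hc2]; linarith
    have := (sq_le_sq₀ (by positivity) (by positivity)).1 h'
    linarith
  have hA : x ≤ 1 / (c - 2) := by
    rw [le_div_iff₀ (by linarith)]
    have : x * (c - 2) ≤ x * (1 / x) := by gcongr; linarith
    rwa [mul_one_div_cancel hx.ne'] at this
  have hB : 1 / (c - 2) ≤ 1.002 / c := by
    rw [div_le_div_iff₀ (by linarith) (by linarith)]
    linarith
  rw [← hc]
  refine ⟨hA, hB, ?_⟩
  rw [mul_div_assoc]
  linarith
end

section
/- Let 0 < y < 1/2 and let C ⊆ ℝ² be a finite set with |C| ≥ 2 such that the square U₁ = [y/2, 1−y/2]² is covered by the closed disks of radius y centered at the points of C, i.e., U₁ ⊆ ⋃_{c ∈ C} {q : dist(q,c) ≤ y}. Then |C| · π · y² ≥ (2π/√27) · (1−y)²; equivalently, |C| ≥ (2/√27) · (1−y)²/y². (This is the covering-density bound: a covering of U₁ by congruent disks has density at least 2π/√27.) -/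
open Real Metric

theorem cdb_generic (P : Finset (ℝ × ℝ)) (f : ℝ × ℝ → ℝ) (δ : ℝ) (hδ : 0 < δ) :
    ∃ h : ℝ × ℝ → ℝ, (∀ p, f p ≤ h p ∧ h p ≤ f p + δ) ∧
      ∀ A ⊆ P, ∀ l : ℝ × ℝ →ᵃ[ℝ] ℝ, (∀ p ∈ A, l p = h p) →
        AffineIndependent ℝ (Subtype.val : {p // p ∈ A} → ℝ × ℝ) := by
  classical
  induction P using Finset.induction_on with
  | empty =>
    refine ⟨f, fun p => ⟨le_rfl, by linarith⟩, ?_⟩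
    intro A hA l _
    have : A = ∅ := Finset.subset_empty.mp hA
    subst this
    have : IsEmpty ((∅ : Finset (ℝ × ℝ)) : Set (ℝ × ℝ)) := by simp
    exact affineIndependent_of_subsingleton ℝ _
  | insert k P hk ih =>
    obtain ⟨h, hb, hG⟩ := ih
    let bad : Finset (ℝ × ℝ) → ℝ := fun A =>
      if hA : ∃ l : ℝ × ℝ →ᵃ[ℝ] ℝ, ∀ p ∈ A, l p = h p then hA.choose k else 0
    have hinf : (Set.Ioo (f k) (f k + δ)).Infinite := Set.Ioo_infinite (by linarith)
    obtain ⟨v, hv, hvb⟩ := hinf.exists_notMem_finset (P.powerset.image bad)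
    refine ⟨Function.update h k v, ?_, ?_⟩
    · intro p
      by_cases hp : p = k
      · subst hp; simp; exact ⟨hv.1.le, hv.2.le⟩
      · simp [Function.update_of_ne hp]; exact hb p
    · intro A hA l hl
      have hA'P : A.erase k ⊆ P := by
        rw [← Finset.subset_insert_iff]; exact hA
      have hl' : ∀ p ∈ A.erase k, l p = h p := by
        intro p hp
        have := hl p (Finset.mem_of_mem_erase hp)
        rwa [Function.update_of_ne (Finset.ne_of_mem_erase hp)] at this
      have hAI := hG _ hA'P l hl'
      by_cases hkA : k ∈ A
      · have hex : ∃ l : ℝ × ℝ →ᵃ[ℝ] ℝ, ∀ p ∈ A.erase k, l p = h p := ⟨l, hl'⟩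
        have hns : k ∉ affineSpan ℝ ((A.erase k : Finset (ℝ × ℝ)) : Set (ℝ × ℝ)) := by
          intro hks
          apply hvb
          rw [Finset.mem_image]
          refine ⟨A.erase k, Finset.mem_powerset.mpr hA'P, ?_⟩
          have h1 : bad (A.erase k) = hex.choose k := by
            simp only [bad]; rw [dif_pos hex]
          have h2 : Set.EqOn hex.choose l ((A.erase k : Finset (ℝ × ℝ)) : Set (ℝ × ℝ)) := by
            intro p hp
            rw [hex.choose_spec p hp, hl' p hp]
          have h3 := AffineMap.eqOn_affineSpan h2 hks
          have h4 := hl k hkA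
          rw [Function.update_self] at h4
          rw [h1, h3, h4]
        have hp : (⟨k, hkA⟩ : {p // p ∈ A}).1 = k := rfl
        refine AffineIndependent.affineIndependent_of_notMem_span (i := ⟨k, hkA⟩) ?_ ?_
        · let e : {y : {p // p ∈ A} // y ≠ ⟨k, hkA⟩} ↪ {p // p ∈ A.erase k} :=
            ⟨fun y => ⟨y.1.1, by
              have := y.2
              have h2 := y.1.2
              simp only [ne_eq, Subtype.ext_iff] at this
              exact Finset.mem_erase.mpr ⟨this, h2⟩⟩, by
              intro a b hab
              simp only [Subtype.mk.injEq] at hab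
              exact Subtype.ext (Subtype.ext hab)⟩
          exact hAI.comp_embedding e
        · intro hmem
          apply hns
          refine affineSpan_mono ℝ ?_ hmem
          rintro _ ⟨x, hx, rfl⟩
          have hx' : x ≠ ⟨k, hkA⟩ := hx
          simp only [ne_eq, Subtype.ext_iff] at hx'
          simp only [Finset.coe_erase, Set.mem_sdiff, Set.mem_singleton_iff]
          exact ⟨x.2, hx'⟩
      · rwa [Finset.erase_eq_of_notMem hkA] at hAI

theorem cdb_card_le {A : Finset (ℝ × ℝ)}
    (h : AffineIndependent ℝ (Subtype.val : {p // p ∈ A} → ℝ × ℝ)) : A.card ≤ 3 := by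
  have h1 := h.card_le_finrank_succ
  have h2 := Submodule.finrank_le (vectorSpan ℝ (Set.range (Subtype.val : {p // p ∈ A} → ℝ × ℝ)))
  have h3 : Module.finrank ℝ (ℝ × ℝ) = 2 := by simp
  simp only [Fintype.card_coe] at h1
  rw [h3] at h2
  omega

theorem cdb_dir (P : Finset (ℝ × ℝ)) : ∃ s : ℝ, ∀ p ∈ P, ∀ q ∈ P, p.1 + s * p.2 = q.1 + s * q.2 → p = q := by
  classical
  obtain ⟨s, hs⟩ := Infinite.exists_notMem_finset
    ((P ×ˢ P).image fun x => -(x.1.1 - x.2.1) / (x.1.2 - x.2.2))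
  refine ⟨s, fun p hp q hq h => ?_⟩
  by_cases h2 : p.2 = q.2
  · ext
    · rw [h2] at h; linarith
    · exact h2
  · exfalso
    apply hs
    rw [Finset.mem_image]
    refine ⟨(p, q), Finset.mk_mem_product hp hq, ?_⟩
    have : p.2 - q.2 ≠ 0 := sub_ne_zero.mpr h2
    simp only
    rw [div_eq_iff this]; linarith

/-- The triangle `t` is a (weighted) Delaunay triangle. -/
def cdbDel (P : Finset (ℝ × ℝ)) (h : ℝ × ℝ → ℝ) (t : Finset (ℝ × ℝ)) : Prop :=
  t ⊆ P ∧ t.card = 3 ∧ ∃ α β γ : ℝ, (∀ p ∈ P, α * p.1 + β * p.2 + γ ≤ h p) ∧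
    ∀ p ∈ t, α * p.1 + β * p.2 + γ = h p

/-- Generic heights. -/
def cdbGen (P : Finset (ℝ × ℝ)) (h : ℝ × ℝ → ℝ) : Prop :=
  ∀ A ⊆ P, ∀ α β γ : ℝ, (∀ p ∈ A, α * p.1 + β * p.2 + γ = h p) → A.card ≤ 3

/-- `m` is the middle vertex of `t`, and `t` lies on the side `σ` of it. -/
def cdbMid (s : ℝ) (t : Finset (ℝ × ℝ)) (x : (ℝ × ℝ) × ℝ) : Prop :=
  ∃ (a b : ℝ × ℝ) (k c : ℝ), (∀ p, p ∈ t ↔ p = a ∨ p = x.1 ∨ p = b) ∧ 0 < k ∧ k < 1 ∧ 0 < c ∧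
    k * a.1 + (1 - k) * b.1 = x.1.1 - x.2 * c * s ∧ k * a.2 + (1 - k) * b.2 = x.1.2 + x.2 * c

theorem cdb_unique (P : Finset (ℝ × ℝ)) (h : ℝ × ℝ → ℝ) (hG : cdbGen P h) (s : ℝ)
    (t₁ t₂ : Finset (ℝ × ℝ)) (h₁ : cdbDel P h t₁) (h₂ : cdbDel P h t₂) (x : (ℝ × ℝ) × ℝ)
    (m₁ : cdbMid s t₁ x) (m₂ : cdbMid s t₂ x) : t₁ = t₂ := by
  classical
  obtain ⟨⟨m, m'⟩, σ⟩ := x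
  obtain ⟨a, b, k, c, ht, hk0, hk1, hc, e1, e2⟩ := m₁
  obtain ⟨a', b', k', c', ht', hk0', hk1', hc', e1', e2'⟩ := m₂
  obtain ⟨hP, hcard, α, β, γ, hle, heq⟩ := h₁
  obtain ⟨hP', hcard', α', β', γ', hle', heq'⟩ := h₂
  simp only at *
  have qa := heq a ((ht _).2 (by simp))
  have qm := heq (m, m') ((ht _).2 (by simp))
  have qb := heq b ((ht _).2 (by simp))
  have qa' := heq' a' ((ht' _).2 (by simp))
  have qm' := heq' (m, m') ((ht' _).2 (by simp))
  have qb' := heq' b' ((ht' _).2 (by simp))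
  have la := hle' a (hP ((ht _).2 (by simp)))
  have lb := hle' b (hP ((ht _).2 (by simp)))
  have la' := hle a' (hP' ((ht' _).2 (by simp)))
  have lb' := hle b' (hP' ((ht' _).2 (by simp)))
  simp only at qm qm'
  have A1 : k * (h a - (α' * a.1 + β' * a.2 + γ')) + (1 - k) * (h b - (α' * b.1 + β' * b.2 + γ'))
      = c * (σ * ((β - β') - s * (α - α'))) := by
    rw [← qa, ← qb]
    linear_combination (α - α') * e1 + (β - β') * e2 + qm - qm'
  have A2 : k' * (h a' - (α * a'.1 + β * a'.2 + γ)) + (1 - k') * (h b' - (α * b'.1 + β * b'.2 + γ))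
      = -(c' * (σ * ((β - β') - s * (α - α')))) := by
    rw [← qa', ← qb']
    linear_combination (α' - α) * e1' + (β' - β) * e2' + qm' - qm
  have B1 : 0 ≤ k * (h a - (α' * a.1 + β' * a.2 + γ')) := mul_nonneg hk0.le (by linarith)
  have B2 : 0 ≤ (1 - k) * (h b - (α' * b.1 + β' * b.2 + γ')) := mul_nonneg (by linarith) (by linarith)
  have B3 : 0 ≤ k' * (h a' - (α * a'.1 + β * a'.2 + γ)) := mul_nonneg hk0'.le (by linarith)
  have B4 : 0 ≤ (1 - k') * (h b' - (α * b'.1 + β * b'.2 + γ)) := mul_nonneg (by linarith) (by linarith)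
  set D := σ * ((β - β') - s * (α - α'))
  have D1 : 0 ≤ D := by
    by_contra hD
    have := mul_neg_of_pos_of_neg hc (not_le.mp hD)
    linarith
  have D2 : D ≤ 0 := by
    by_contra hD
    have := mul_pos hc' (not_le.mp hD)
    linarith
  have D0 : D = 0 := le_antisymm D2 D1
  rw [D0] at A1
  have C1 : k * (h a - (α' * a.1 + β' * a.2 + γ')) = 0 := by linarith
  have C2 : (1 - k) * (h b - (α' * b.1 + β' * b.2 + γ')) = 0 := by linarith
  have E1 : h a - (α' * a.1 + β' * a.2 + γ') = 0 := (mul_eq_zero.mp C1).resolve_left hk0.ne'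
  have E2 : h b - (α' * b.1 + β' * b.2 + γ') = 0 := (mul_eq_zero.mp C2).resolve_left (by linarith)
  have hu : (t₁ ∪ t₂).card ≤ 3 := by
    apply hG _ (Finset.union_subset hP hP') α' β' γ'
    intro p hp
    rcases Finset.mem_union.mp hp with hp | hp
    · rcases (ht p).1 hp with rfl | rfl | rfl
      · linarith
      · exact qm'
      · linarith
    · exact heq' p hp
  have u1 : t₁ = t₁ ∪ t₂ := Finset.eq_of_subset_of_card_le Finset.subset_union_left (by omega)
  have u2 : t₂ = t₁ ∪ t₂ := Finset.eq_of_subset_of_card_le Finset.subset_union_right (by omega)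
  rw [u1, ← u2]

theorem cdb_mid_aux (s : ℝ) (t : Finset (ℝ × ℝ)) (a m b : ℝ × ℝ)
    (ht : ∀ p, p ∈ t ↔ p = a ∨ p = m ∨ p = b) (h1 : a.1 + s * a.2 < m.1 + s * m.2)
    (h2 : m.1 + s * m.2 < b.1 + s * b.2)
    (hdet : (m.1 - a.1) * (b.2 - a.2) - (b.1 - a.1) * (m.2 - a.2) ≠ 0) :
    ∃ σ : ℝ, (σ = 1 ∨ σ = -1) ∧ cdbMid s t (m, σ) := by
  have hba : 0 < (b.1 + s * b.2) - (a.1 + s * a.2) := by linarith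
  set k := ((b.1 + s * b.2) - (m.1 + s * m.2)) / ((b.1 + s * b.2) - (a.1 + s * a.2)) with hk
  have hk0 : 0 < k := div_pos (by linarith) hba
  have hk1 : k < 1 := by rw [hk, div_lt_one hba]; linarith
  have hkm : k * ((b.1 + s * b.2) - (a.1 + s * a.2)) = (b.1 + s * b.2) - (m.1 + s * m.2) :=
    div_mul_cancel₀ _ hba.ne'
  set c := k * a.2 + (1 - k) * b.2 - m.2 with hc
  have hfst : k * a.1 + (1 - k) * b.1 = m.1 - c * s := by
    rw [hc]; linear_combination -hkm
  have hc0 : c ≠ 0 := by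
    intro h0
    apply hdet
    rw [h0] at hfst hc
    have x1 : m.1 = k * a.1 + (1 - k) * b.1 := by linarith
    have x2 : m.2 = k * a.2 + (1 - k) * b.2 := by linarith
    rw [x1, x2]; ring
  rcases lt_or_gt_of_ne hc0 with hneg | hpos
  · exact ⟨-1, Or.inr rfl, a, b, k, -c, ht, hk0, hk1, by linarith, by simp only; linarith, by simp only; linarith⟩
  · exact ⟨1, Or.inl rfl, a, b, k, c, ht, hk0, hk1, hpos, by simp only; linarith, by simp only; linarith⟩

theorem cdb_mid_exists (P : Finset (ℝ × ℝ)) (s : ℝ)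
    (hs : ∀ p ∈ P, ∀ q ∈ P, p.1 + s * p.2 = q.1 + s * q.2 → p = q)
    (t : Finset (ℝ × ℝ)) (htP : t ⊆ P) (hcard : t.card = 3)
    (hdet : ∀ a b c, (∀ p, p ∈ t ↔ p = a ∨ p = b ∨ p = c) →
      (b.1 - a.1) * (c.2 - a.2) - (c.1 - a.1) * (b.2 - a.2) ≠ 0) :
    ∃ x ∈ P ×ˢ ({1, -1} : Finset ℝ), cdbMid s t x := by
  classical
  have key : ∀ a m b : ℝ × ℝ, (∀ p, p ∈ t ↔ p = a ∨ p = m ∨ p = b) → a.1 + s * a.2 < m.1 + s * m.2 →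
      m.1 + s * m.2 < b.1 + s * b.2 → ∃ x ∈ P ×ˢ ({1, -1} : Finset ℝ), cdbMid s t x := by
    intro a m b ht h1 h2
    obtain ⟨σ, hσ, hm⟩ := cdb_mid_aux s t a m b ht h1 h2 (hdet a m b ht)
    refine ⟨(m, σ), Finset.mk_mem_product (htP ((ht m).2 (by simp))) (by simpa using hσ), hm⟩
  obtain ⟨u, v, w, huv, huw, hvw, rfl⟩ := Finset.card_eq_three.mp hcard
  have hu : u ∈ P := htP (by simp)
  have hv : v ∈ P := htP (by simp)
  have hw : w ∈ P := htP (by simp)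
  rcases lt_or_gt_of_ne (fun h => huv (hs u hu v hv h)) with h1 | h1 <;>
  rcases lt_or_gt_of_ne (fun h => huw (hs u hu w hw h)) with h2 | h2 <;>
  rcases lt_or_gt_of_ne (fun h => hvw (hs v hv w hw h)) with h3 | h3
  · exact key u v w (by intro p; simp) h1 h3
  · exact key u w v (by intro p; simp; tauto) h2 h3
  · linarith
  · exact key w u v (by intro p; simp; tauto) h2 h1
  · exact key v u w (by intro p; simp; tauto) h1 h2
  · linarith
  · exact key v w u (by intro p; simp; tauto) h3 h2
  · exact key w v u (by intro p; simp; tauto) h3 h1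

theorem cdb_count (P : Finset (ℝ × ℝ)) (h : ℝ × ℝ → ℝ) (hG : cdbGen P h)
    (T : Finset (Finset (ℝ × ℝ))) (hT : ∀ t ∈ T, cdbDel P h t)
    (hdet : ∀ t ∈ T, ∀ a b c, (∀ p, p ∈ t ↔ p = a ∨ p = b ∨ p = c) →
      (b.1 - a.1) * (c.2 - a.2) - (c.1 - a.1) * (b.2 - a.2) ≠ 0) :
    T.card ≤ P.card * 2 := by
  classical
  obtain ⟨s, hs⟩ := cdb_dir P
  have hex : ∀ t : Finset (ℝ × ℝ), ∃ x : (ℝ × ℝ) × ℝ, t ∈ T → x ∈ P ×ˢ ({1, -1} : Finset ℝ) ∧ cdbMid s t x := by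
    intro t
    by_cases ht : t ∈ T
    · obtain ⟨x, hx, hm⟩ := cdb_mid_exists P s hs t (hT t ht).1 (hT t ht).2.1 (hdet t ht)
      exact ⟨x, fun _ => ⟨hx, hm⟩⟩
    · exact ⟨0, fun h => absurd h ht⟩
  choose f hf using hex
  have h1 : T.card ≤ (P ×ˢ ({1, -1} : Finset ℝ)).card := by
    apply Finset.card_le_card_of_injOn f
    · intro t ht; exact (hf t ht).1
    · intro t ht t' ht' heq
      refine cdb_unique P h hG s t t' (hT t ht) (hT t' ht') (f t) (hf t ht).2 ?_
      rw [heq]; exact (hf t' ht').2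
  rw [Finset.card_product] at h1
  exact h1.trans (Nat.mul_le_mul_left _ (Finset.card_le_two))

def cdbD (p q : ℝ × ℝ) : ℝ := (p.1 - q.1) ^ 2 + (p.2 - q.2) ^ 2

theorem cdb_compact (x : ℝ × ℝ) (R : ℝ) : IsCompact {z : ℝ × ℝ | cdbD x z ≤ R ^ 2} := by
  apply Metric.isCompact_of_isClosed_isBounded
  · apply isClosed_le
    · unfold cdbD; fun_prop
    · fun_prop
  · refine (Metric.isBounded_closedBall (x := x) (r := |R|)).subset ?_
    intro z hz
    simp only [Set.mem_ofPred_eq, cdbD] at hz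
    rw [Metric.mem_closedBall, Prod.dist_eq, Real.dist_eq, Real.dist_eq]
    apply max_le <;> apply sq_le_sq.mp <;> nlinarith [sq_nonneg (x.1 - z.1), sq_nonneg (x.2 - z.2)]

theorem cdb_exists (P : Finset (ℝ × ℝ)) (y δ : ℝ) (hy : 0 < y) (hδ' : δ < 3 * y ^ 2)
    (h : ℝ × ℝ → ℝ) (hh : ∀ p, p.1 ^ 2 + p.2 ^ 2 ≤ h p ∧ h p ≤ p.1 ^ 2 + p.2 ^ 2 + δ)
    (x : ℝ × ℝ) (hx : ∀ z, cdbD x z ≤ (2 * y) ^ 2 → ∃ p ∈ P, cdbD p z ≤ y ^ 2) :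
    ∃ (z : ℝ × ℝ) (r : ℝ), r ≤ y ^ 2 + δ ∧
      (∀ p ∈ P, r ≤ cdbD p z + (h p - p.1 ^ 2 - p.2 ^ 2)) ∧
      x ∈ convexHull ℝ ((P.filter fun p => cdbD p z + (h p - p.1 ^ 2 - p.2 ^ 2) = r : Finset (ℝ × ℝ)) : Set (ℝ × ℝ)) := by
  classical
  have hxx : cdbD x x = 0 := by simp [cdbD]
  have hPne : P.Nonempty := by
    obtain ⟨p, hp, _⟩ := hx x (by rw [hxx]; positivity)
    exact ⟨p, hp⟩
  let G : ℝ × ℝ → ℝ × ℝ → ℝ := fun p z => cdbD p z + (h p - p.1 ^ 2 - p.2 ^ 2)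
  let r : ℝ × ℝ → ℝ := fun z => P.inf' hPne (fun p => G p z)
  have hrc : Continuous r := by
    apply Continuous.finset_inf'_apply
    intro p _
    simp only [G, cdbD]; fun_prop
  have hDc : Continuous fun z => cdbD x z := by unfold cdbD; fun_prop
  obtain ⟨z, hzK, hzmax⟩ := (cdb_compact x (2 * y)).exists_isMaxOn ⟨x, by simp only [Set.mem_ofPred_eq]; rw [hxx]; positivity⟩
    (f := fun z => r z - cdbD x z) (by fun_prop)
  have hzK' : cdbD x z ≤ (2 * y) ^ 2 := hzK
  have hrle : r z ≤ y ^ 2 + δ := by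
    obtain ⟨p, hp, hpz⟩ := hx z hzK'
    have h1 : r z ≤ G p z := Finset.inf'_le _ hp
    have := (hh p).2
    simp only [G] at h1
    linarith
  have hr0 : 0 ≤ r x := by
    apply Finset.le_inf'
    intro p _
    have := (hh p).1
    simp only [G, cdbD]
    nlinarith [sq_nonneg (p.1 - x.1), sq_nonneg (p.2 - x.2)]
  have hmx : r x - cdbD x x ≤ r z - cdbD x z := hzmax (by simp only [Set.mem_ofPred_eq]; rw [hxx]; positivity)
  have hzlt : cdbD x z < (2 * y) ^ 2 := by
    rw [hxx] at hmx
    nlinarith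
  refine ⟨z, r z, hrle, fun p hp => Finset.inf'_le _ hp, ?_⟩
  by_contra hnot
  set A := P.filter fun p => cdbD p z + (h p - p.1 ^ 2 - p.2 ^ 2) = r z with hA
  have hcl : IsClosed (convexHull ℝ (A : Set (ℝ × ℝ))) := A.finite_toSet.isClosed_convexHull ℝ
  obtain ⟨f, u, hfx, hfA⟩ := geometric_hahn_banach_point_closed (convex_convexHull ℝ _) hcl hnot
  have hf : ∀ v : ℝ × ℝ, f v = v.1 * f (1, 0) + v.2 * f (0, 1) := by
    intro v
    have : v = v.1 • ((1 : ℝ), (0 : ℝ)) + v.2 • ((0 : ℝ), (1 : ℝ)) := by ext <;> simp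
    conv_lhs => rw [this]
    rw [map_add, map_smul, map_smul]; simp
  set d1 := f (1, 0)
  set d2 := f (0, 1)
  let w : ℝ → ℝ × ℝ := fun e => (z.1 - e * d1, z.2 - e * d2)
  have hw0 : w 0 = z := by simp [w]
  have hwc : Continuous w := by simp only [w]; fun_prop
  have hkey : ∀ p e, G p (w e) - cdbD x (w e) = G p z - cdbD x z + 2 * e * (f p - f x) := by
    intro p e
    rw [hf p, hf x]
    simp only [G, cdbD, w]; ring
  have hev1 : ∀ᶠ e in nhdsWithin (0 : ℝ) (Set.Ioi 0), cdbD x (w e) < (2 * y) ^ 2 := by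
    apply Filter.Eventually.filter_mono nhdsWithin_le_nhds
    have hc : Continuous fun e => cdbD x (w e) := hDc.comp hwc
    exact hc.continuousAt.eventually_lt continuousAt_const (by rw [hw0]; exact hzlt)
  have hev2 : ∀ᶠ e in nhdsWithin (0 : ℝ) (Set.Ioi 0), ∀ p ∈ P,
      r z - cdbD x z < G p (w e) - cdbD x (w e) := by
    rw [Filter.eventually_all_finset]
    intro p hp
    by_cases hpA : p ∈ A
    · filter_upwards [self_mem_nhdsWithin] with e he
      rw [hkey]
      have h1 : G p z = r z := (Finset.mem_filter.mp hpA).2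
      have h2 := hfA p (subset_convexHull ℝ _ hpA)
      have he' : (0 : ℝ) < e := he
      have : 0 < 2 * e * (f p - f x) := by
        apply mul_pos <;> linarith
      linarith
    · apply Filter.Eventually.filter_mono nhdsWithin_le_nhds
      have h1 : r z < G p z := by
        refine lt_of_le_of_ne (Finset.inf'_le _ hp) ?_
        intro heq
        exact hpA (Finset.mem_filter.mpr ⟨hp, heq.symm⟩)
      have hc : Continuous fun e => G p (w e) - cdbD x (w e) := by
        simp only [G, cdbD, w]; fun_prop
      refine continuousAt_const.eventually_lt hc.continuousAt ?_
      rw [hw0]; linarith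
  obtain ⟨e, he1, he2⟩ := (hev1.and hev2).exists
  have h1 : r (w e) - cdbD x (w e) ≤ r z - cdbD x z := hzmax he1.le
  have h2 : r z - cdbD x z + cdbD x (w e) < r (w e) := by
    rw [Finset.lt_inf'_iff]
    intro p hp
    have := he2 p hp
    linarith
  linarith

theorem cdb_std_triangle :
    MeasureTheory.volume {v : ℝ × ℝ | 0 ≤ v.1 ∧ 0 ≤ v.2 ∧ v.1 + v.2 ≤ 1} ≤ ENNReal.ofReal (1 / 2) := by
  have hm : MeasurableSet {v : ℝ × ℝ | 0 ≤ v.1 ∧ 0 ≤ v.2 ∧ v.1 + v.2 ≤ 1} := by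
    apply IsClosed.measurableSet
    apply IsClosed.and (isClosed_le (by fun_prop) (by fun_prop))
    apply IsClosed.and (isClosed_le (by fun_prop) (by fun_prop))
    exact isClosed_le (by fun_prop) (by fun_prop)
  rw [MeasureTheory.Measure.volume_eq_prod, MeasureTheory.Measure.prod_apply hm]
  have h1 : ∀ x : ℝ, MeasureTheory.volume (Prod.mk x ⁻¹' {v : ℝ × ℝ | 0 ≤ v.1 ∧ 0 ≤ v.2 ∧ v.1 + v.2 ≤ 1})
      ≤ (Set.Icc (0 : ℝ) 1).indicator (fun x => ENNReal.ofReal (1 - x)) x := by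
    intro x
    by_cases hx : x ∈ Set.Icc (0 : ℝ) 1
    · rw [Set.indicator_of_mem hx]
      calc _ ≤ MeasureTheory.volume (Set.Icc (0 : ℝ) (1 - x)) := by
            apply MeasureTheory.measure_mono
            intro y hy
            have hy' : 0 ≤ x ∧ 0 ≤ y ∧ x + y ≤ 1 := hy
            exact ⟨hy'.2.1, by linarith [hy'.2.2]⟩
        _ = _ := by rw [Real.volume_Icc]; simp
    · rw [Set.indicator_of_notMem hx]
      have : Prod.mk x ⁻¹' {v : ℝ × ℝ | 0 ≤ v.1 ∧ 0 ≤ v.2 ∧ v.1 + v.2 ≤ 1} = ∅ := by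
        rw [Set.eq_empty_iff_forall_notMem]
        intro y hy
        have hy' : 0 ≤ x ∧ 0 ≤ y ∧ x + y ≤ 1 := hy
        exact hx ⟨hy'.1, by linarith [hy'.2.1, hy'.2.2]⟩
      rw [this]; simp
  refine (MeasureTheory.lintegral_mono h1).trans ?_
  rw [MeasureTheory.lintegral_indicator measurableSet_Icc,
    ← MeasureTheory.ofReal_integral_eq_lintegral_ofReal]
  · apply ENNReal.ofReal_le_ofReal
    rw [MeasureTheory.integral_Icc_eq_integral_Ioc, ← intervalIntegral.integral_of_le (by norm_num)]
    rw [intervalIntegral.integral_sub (by simp) (by simp)]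
    simp; norm_num
  · exact (by fun_prop : Continuous fun x : ℝ => 1 - x).integrableOn_Icc
  · filter_upwards [MeasureTheory.ae_restrict_mem measurableSet_Icc] with x hx
    simp; exact hx.2

theorem cdb_area (a b c : ℝ × ℝ) :
    MeasureTheory.volume (convexHull ℝ ({a, b, c} : Set (ℝ × ℝ))) ≤
      ENNReal.ofReal (|(b.1 - a.1) * (c.2 - a.2) - (c.1 - a.1) * (b.2 - a.2)| / 2) := by
  let M : Matrix (Fin 2) (Fin 2) ℝ := !![b.1 - a.1, c.1 - a.1; b.2 - a.2, c.2 - a.2]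
  let L : ℝ × ℝ →ₗ[ℝ] ℝ × ℝ := Matrix.toLin (Module.Basis.finTwoProd ℝ) (Module.Basis.finTwoProd ℝ) M
  have hL : ∀ v : ℝ × ℝ, L v = ((b.1 - a.1) * v.1 + (c.1 - a.1) * v.2, (b.2 - a.2) * v.1 + (c.2 - a.2) * v.2) := by
    intro v
    simp only [L, M]
    rw [Matrix.toLin_finTwoProd_apply]
  have hdet : LinearMap.det L = (b.1 - a.1) * (c.2 - a.2) - (c.1 - a.1) * (b.2 - a.2) := by
    simp only [L, LinearMap.det_toLin, M, Matrix.det_fin_two_of]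
  set T0 : Set (ℝ × ℝ) := {v : ℝ × ℝ | 0 ≤ v.1 ∧ 0 ≤ v.2 ∧ v.1 + v.2 ≤ 1} with hT0
  have hTc : Convex ℝ T0 := by
    intro u hu v hv s t hs ht hst
    obtain ⟨u1, u2, u3⟩ := hu
    obtain ⟨v1, v2, v3⟩ := hv
    refine ⟨?_, ?_, ?_⟩ <;> simp
    · positivity
    · positivity
    · nlinarith
  have hsub : convexHull ℝ ({a, b, c} : Set (ℝ × ℝ)) ⊆ (fun x => a + x) '' (L '' T0) := by
    apply convexHull_min
    · intro p hp
      simp only [Set.mem_insert_iff, Set.mem_singleton_iff] at hp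
      rcases hp with rfl | rfl | rfl
      · exact ⟨_, ⟨(0, 0), by simp [hT0], rfl⟩, by rw [hL]; ext <;> simp⟩
      · exact ⟨_, ⟨(1, 0), by simp [hT0], rfl⟩, by rw [hL]; ext <;> simp⟩
      · exact ⟨_, ⟨(0, 1), by simp [hT0], rfl⟩, by rw [hL]; ext <;> simp⟩
    · exact (hTc.linear_image L).translate a
  refine (MeasureTheory.measure_mono hsub).trans ?_
  rw [Set.image_add_left, MeasureTheory.measure_preimage_add, MeasureTheory.Measure.addHaar_image_linearMap, hdet]
  refine (mul_le_mul_right cdb_std_triangle _).trans ?_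
  rw [← ENNReal.ofReal_mul (abs_nonneg _)]
  apply le_of_eq; congr 1; ring

theorem cdb_det_bound (a b c z : ℝ × ℝ) (r : ℝ)
    (ha : (a.1 - z.1) ^ 2 + (a.2 - z.2) ^ 2 ≤ r) (hb : (b.1 - z.1) ^ 2 + (b.2 - z.2) ^ 2 ≤ r)
    (hc : (c.1 - z.1) ^ 2 + (c.2 - z.2) ^ 2 ≤ r) :
    |(b.1 - a.1) * (c.2 - a.2) - (c.1 - a.1) * (b.2 - a.2)| / 2 ≤ 3 * √3 / 4 * r := by
  have h3 : √3 * √3 = 3 := Real.mul_self_sqrt (by norm_num)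
  have hs : (0 : ℝ) < √3 := by positivity
  obtain ⟨a1, a2⟩ := a
  obtain ⟨b1, b2⟩ := b
  obtain ⟨c1, c2⟩ := c
  obtain ⟨z1, z2⟩ := z
  simp only at *
  have hS : (b1 - a1) ^ 2 + (b2 - a2) ^ 2 + (c1 - a1) ^ 2 + (c2 - a2) ^ 2 + (c1 - b1) ^ 2 + (c2 - b2) ^ 2 ≤ 9 * r := by
    nlinarith [sq_nonneg (a1 + b1 + c1 - 3 * z1), sq_nonneg (a2 + b2 + c2 - 3 * z2)]
  set S := (b1 - a1) ^ 2 + (b2 - a2) ^ 2 + (c1 - a1) ^ 2 + (c2 - a2) ^ 2 + (c1 - b1) ^ 2 + (c2 - b2) ^ 2 with hSd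
  have hW : 2 * √3 * |(b1 - a1) * (c2 - a2) - (c1 - a1) * (b2 - a2)| ≤ S := by
    rcases abs_cases ((b1 - a1) * (c2 - a2) - (c1 - a1) * (b2 - a2)) with h | h
    · rw [h.1]
      have e : S - 2 * √3 * ((b1 - a1) * (c2 - a2) - (c1 - a1) * (b2 - a2)) =
        1 / 2 * ((2 * (c1 - a1) - (b1 - a1) + √3 * (b2 - a2)) ^ 2 + (2 * (c2 - a2) - (b2 - a2) - √3 * (b1 - a1)) ^ 2) := by
        rw [hSd]; linear_combination (-1 / 2 * ((b1 - a1) ^ 2 + (b2 - a2) ^ 2)) * h3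
      have := add_nonneg (sq_nonneg (2 * (c1 - a1) - (b1 - a1) + √3 * (b2 - a2))) (sq_nonneg (2 * (c2 - a2) - (b2 - a2) - √3 * (b1 - a1)))
      linarith
    · rw [h.1]
      have e : S - 2 * √3 * (-((b1 - a1) * (c2 - a2) - (c1 - a1) * (b2 - a2))) =
        1 / 2 * ((2 * (c1 - a1) - (b1 - a1) - √3 * (b2 - a2)) ^ 2 + (2 * (c2 - a2) - (b2 - a2) + √3 * (b1 - a1)) ^ 2) := by
        rw [hSd]; linear_combination (-1 / 2 * ((b1 - a1) ^ 2 + (b2 - a2) ^ 2)) * h3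
      have := add_nonneg (sq_nonneg (2 * (c1 - a1) - (b1 - a1) - √3 * (b2 - a2))) (sq_nonneg (2 * (c2 - a2) - (b2 - a2) + √3 * (b1 - a1)))
      linarith
  have hW' : 2 * √3 * |(b1 - a1) * (c2 - a2) - (c1 - a1) * (b2 - a2)| ≤ 9 * r := hW.trans hS
  have := mul_le_mul_of_nonneg_left hW' hs.le
  nlinarith

theorem cdb_area_bound (P : Finset (ℝ × ℝ)) (y δ : ℝ) (hy : 0 < y) (hδ : 0 < δ) (hδ' : δ < 3 * y ^ 2)
    (S : Set (ℝ × ℝ))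
    (hS : ∀ x ∈ S, ∀ z, cdbD x z ≤ (2 * y) ^ 2 → ∃ p ∈ P, cdbD p z ≤ y ^ 2) :
    MeasureTheory.volume S ≤ ENNReal.ofReal ((P.card : ℝ) * (3 * √3 / 2) * (y ^ 2 + δ)) := by
  classical
  obtain ⟨h, hh, hAI⟩ := cdb_generic P (fun p => p.1 ^ 2 + p.2 ^ 2) δ hδ
  have hG : cdbGen P h := by
    intro A hA α β γ hA'
    refine cdb_card_le (hAI A hA ((α • LinearMap.fst ℝ ℝ ℝ + β • LinearMap.snd ℝ ℝ ℝ).toAffineMap +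
      AffineMap.const ℝ (ℝ × ℝ) γ) ?_)
    intro p hp
    rw [← hA' p hp]
    simp
  let T : Finset (Finset (ℝ × ℝ)) := P.powerset.filter fun t => cdbDel P h t ∧
    (∀ a b c, (∀ p, p ∈ t ↔ p = a ∨ p = b ∨ p = c) →
      (b.1 - a.1) * (c.2 - a.2) - (c.1 - a.1) * (b.2 - a.2) ≠ 0) ∧
    ∃ z, ∀ p ∈ t, cdbD p z ≤ y ^ 2 + δ
  let N : Finset (Finset (ℝ × ℝ)) := P.powerset.filter fun t =>
    MeasureTheory.volume (convexHull ℝ (t : Set (ℝ × ℝ))) = 0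
  have hcov : S ⊆ (⋃ t ∈ T, convexHull ℝ (t : Set (ℝ × ℝ))) ∪ ⋃ t ∈ N, convexHull ℝ (t : Set (ℝ × ℝ)) := by
    intro x hx
    obtain ⟨z, r, hr, hle, hxA⟩ := cdb_exists P y δ hy hδ' h hh x (hS x hx)
    set A := P.filter fun p => cdbD p z + (h p - p.1 ^ 2 - p.2 ^ 2) = r with hA
    have hAP : A ⊆ P := Finset.filter_subset _ _
    have hAeq : ∀ p ∈ A, 2 * z.1 * p.1 + 2 * z.2 * p.2 + (r - z.1 ^ 2 - z.2 ^ 2) = h p := by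
      intro p hp
      have := (Finset.mem_filter.mp hp).2
      simp only [cdbD] at this
      linarith
    have hPle : ∀ p ∈ P, 2 * z.1 * p.1 + 2 * z.2 * p.2 + (r - z.1 ^ 2 - z.2 ^ 2) ≤ h p := by
      intro p hp
      have := hle p hp
      simp only [cdbD] at this
      linarith
    have hc3 : A.card ≤ 3 := hG A hAP _ _ _ hAeq
    by_cases hv : MeasureTheory.volume (convexHull ℝ (A : Set (ℝ × ℝ))) = 0
    · right
      exact Set.mem_biUnion (show A ∈ (N : Set _) from Finset.mem_filter.mpr ⟨Finset.mem_powerset.mpr hAP, hv⟩) hxA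
    · left
      have hdet : ∀ a b c, (∀ p, p ∈ A → p = a ∨ p = b ∨ p = c) →
          (b.1 - a.1) * (c.2 - a.2) - (c.1 - a.1) * (b.2 - a.2) ≠ 0 := by
        intro a b c habc h0
        apply hv
        have h1 := cdb_area a b c
        rw [h0] at h1
        simp only [abs_zero, zero_div, ENNReal.ofReal_zero, nonpos_iff_eq_zero] at h1
        refine MeasureTheory.measure_mono_null (convexHull_mono ?_) h1
        intro p hp
        simpa using habc p hp
      have hcard : A.card = 3 := by
        by_contra hne
        have h2 : A.card ≤ 2 := by omega
        have : ∃ a b : ℝ × ℝ, ∀ p ∈ A, p = a ∨ p = b := by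
          rcases Nat.lt_or_ge A.card 2 with h3 | h3
          · have h4 := Finset.card_le_one.mp (show A.card ≤ 1 by omega)
            rcases A.eq_empty_or_nonempty with h5 | ⟨q, hq⟩
            · exact ⟨0, 0, by simp [h5]⟩
            · exact ⟨q, q, fun p hp => Or.inl (h4 p hp q hq)⟩
          · obtain ⟨a, b, _, hab⟩ := Finset.card_eq_two.mp (le_antisymm h2 h3)
            exact ⟨a, b, by rw [hab]; simp⟩
        obtain ⟨a, b, hab⟩ := this
        refine hdet a b b (fun p hp => ?_) (by ring)
        rcases hab p hp with h | h <;> simp [h]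
      refine Set.mem_biUnion (show A ∈ (T : Set _) from Finset.mem_filter.mpr ⟨Finset.mem_powerset.mpr hAP,
        ⟨hAP, hcard, _, _, _, hPle, hAeq⟩, fun a b c habc => hdet a b c (fun p hp => (habc p).1 hp), z, ?_⟩) hxA
      intro p hp
      have h1 := (Finset.mem_filter.mp hp).2
      have := (hh p).1
      linarith
  have hcount : T.card ≤ P.card * 2 :=
    cdb_count P h hG T (fun t ht => (Finset.mem_filter.mp ht).2.1) (fun t ht => (Finset.mem_filter.mp ht).2.2.1)
  have hnull : MeasureTheory.volume (⋃ t ∈ N, convexHull ℝ (t : Set (ℝ × ℝ))) = 0 := by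
    refine (MeasureTheory.measure_biUnion_null_iff N.countable_toSet).mpr ?_
    intro t ht
    exact (Finset.mem_filter.mp ht).2
  have hB : 0 ≤ 3 * √3 / 4 * (y ^ 2 + δ) := by positivity
  calc MeasureTheory.volume S ≤ _ := MeasureTheory.measure_mono hcov
    _ ≤ _ := MeasureTheory.measure_union_le _ _
    _ = MeasureTheory.volume (⋃ t ∈ T, convexHull ℝ (t : Set (ℝ × ℝ))) := by rw [hnull, add_zero]
    _ ≤ ∑ t ∈ T, MeasureTheory.volume (convexHull ℝ (t : Set (ℝ × ℝ))) := MeasureTheory.measure_biUnion_finset_le _ _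
    _ ≤ ∑ t ∈ T, ENNReal.ofReal (3 * √3 / 4 * (y ^ 2 + δ)) := by
        apply Finset.sum_le_sum
        intro t ht
        obtain ⟨_, ⟨_, hcard, _⟩, _, z, hz⟩ := Finset.mem_filter.mp ht
        obtain ⟨a, b, c, _, _, _, rfl⟩ := Finset.card_eq_three.mp hcard
        have h1 := cdb_area a b c
        have h2 := cdb_det_bound a b c z _ (hz a (by simp)) (hz b (by simp)) (hz c (by simp))
        simp only [Finset.coe_insert, Finset.coe_singleton]
        exact h1.trans (ENNReal.ofReal_le_ofReal h2)
    _ = ENNReal.ofReal ((T.card : ℝ) * (3 * √3 / 4 * (y ^ 2 + δ))) := by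
        rw [Finset.sum_const, nsmul_eq_mul, ENNReal.ofReal_mul (p := (T.card : ℝ)) (by positivity),
          ENNReal.ofReal_natCast]
    _ ≤ _ := by
        apply ENNReal.ofReal_le_ofReal
        have : (T.card : ℝ) ≤ P.card * 2 := by exact_mod_cast hcount
        have := mul_le_mul_of_nonneg_right this hB
        linarith

theorem cdb_square (P : Finset (ℝ × ℝ)) (y o L : ℝ) (hy : 0 < y) (hL : 4 * y ≤ L)
    (hP : ∀ z : ℝ × ℝ, z.1 ∈ Set.Icc o (o + L) → z.2 ∈ Set.Icc o (o + L) → ∃ p ∈ P, cdbD p z ≤ y ^ 2) :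
    (L - 4 * y) ^ 2 ≤ (P.card : ℝ) * (3 * √3 / 2) * y ^ 2 := by
  have key : ∀ δ : ℝ, 0 < δ → δ < 3 * y ^ 2 → (L - 4 * y) ^ 2 ≤ (P.card : ℝ) * (3 * √3 / 2) * (y ^ 2 + δ) := by
    intro δ h1 h2
    have := cdb_area_bound P y δ hy h1 h2 (Set.Icc (o + 2 * y) (o + L - 2 * y) ×ˢ Set.Icc (o + 2 * y) (o + L - 2 * y)) ?_
    · rw [MeasureTheory.Measure.volume_eq_prod, MeasureTheory.Measure.prod_prod, Real.volume_Icc,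
        ← ENNReal.ofReal_mul (by linarith), ENNReal.ofReal_le_ofReal_iff (by positivity)] at this
      calc _ = _ := by ring
        _ ≤ _ := this
    · rintro x ⟨⟨hx1, hx2⟩, hx3, hx4⟩ z hz
      simp only [cdbD] at hz
      have a1 := abs_le_of_sq_le_sq' (show (x.1 - z.1) ^ 2 ≤ (2 * y) ^ 2 by nlinarith [sq_nonneg (x.2 - z.2)]) (by linarith)
      have a2 := abs_le_of_sq_le_sq' (show (x.2 - z.2) ^ 2 ≤ (2 * y) ^ 2 by nlinarith [sq_nonneg (x.1 - z.1)]) (by linarith)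
      exact hP z ⟨by linarith, by linarith⟩ ⟨by linarith, by linarith⟩
  have hc : Filter.Tendsto (fun δ : ℝ => (P.card : ℝ) * (3 * √3 / 2) * (y ^ 2 + δ)) (nhdsWithin 0 (Set.Ioi 0))
      (nhds ((P.card : ℝ) * (3 * √3 / 2) * (y ^ 2 + 0))) := by
    apply Filter.Tendsto.mono_left _ nhdsWithin_le_nhds
    exact (by fun_prop : Continuous fun δ : ℝ => (P.card : ℝ) * (3 * √3 / 2) * (y ^ 2 + δ)).tendsto 0
  rw [add_zero] at hc
  refine ge_of_tendsto hc ?_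
  filter_upwards [Ioo_mem_nhdsGT (show (0 : ℝ) < 3 * y ^ 2 by positivity)] with δ hδ
  exact key δ hδ.1 hδ.2

theorem cdb_index (s : ℝ) (K : ℕ) (u : ℝ) (h0 : 0 ≤ u) (h1 : u ≤ ((K + 1 : ℕ) : ℝ) * s) :
    ∃ i < K + 1, (i : ℝ) * s ≤ u ∧ u ≤ i * s + s := by
  induction K with
  | zero => exact ⟨0, by simp, by simpa using h0, by simpa using h1⟩
  | succ K ih =>
    by_cases h : u ≤ ((K + 1 : ℕ) : ℝ) * s
    · obtain ⟨i, hi, hi'⟩ := ih h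
      exact ⟨i, by omega, hi'⟩
    · refine ⟨K + 1, by omega, (not_le.mp h).le, ?_⟩
      push_cast at h1 ⊢
      linarith

theorem cdb_tile (P : Finset (ℝ × ℝ)) (y o s : ℝ) (hy : 0 < y) (hs : 0 < s)
    (hP : ∀ z : ℝ × ℝ, z.1 ∈ Set.Icc o (o + s) → z.2 ∈ Set.Icc o (o + s) → ∃ p ∈ P, cdbD p z ≤ y ^ 2) :
    s ^ 2 ≤ (P.card : ℝ) * (3 * √3 / 2) * y ^ 2 := by
  classical
  have key : ∀ K : ℕ, 4 * y ≤ ((K + 1 : ℕ) : ℝ) * s →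
      (s - 4 * y / ((K : ℝ) + 1)) ^ 2 ≤ (P.card : ℝ) * (3 * √3 / 2) * y ^ 2 := by
    intro K hK
    let Q : Finset (ℝ × ℝ) := (P ×ˢ (Finset.range (K + 1) ×ˢ Finset.range (K + 1))).image
      fun x => (x.1.1 + x.2.1 * s, x.1.2 + x.2.2 * s)
    have hQ : (Q.card : ℝ) ≤ P.card * ((K : ℝ) + 1) ^ 2 := by
      have h1 : Q.card ≤ P.card * ((K + 1) * (K + 1)) := by
        refine Finset.card_image_le.trans ?_
        rw [Finset.card_product, Finset.card_product, Finset.card_range]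
      have h2 : (Q.card : ℝ) ≤ ((P.card * ((K + 1) * (K + 1)) : ℕ) : ℝ) := by exact_mod_cast h1
      push_cast at h2
      linarith
    have h1 := cdb_square Q y o (((K + 1 : ℕ) : ℝ) * s) hy hK ?_
    · have hK0 : (0 : ℝ) < (K : ℝ) + 1 := by positivity
      have h2 : (s - 4 * y / ((K : ℝ) + 1)) ^ 2 * ((K : ℝ) + 1) ^ 2 ≤
          ((P.card : ℝ) * (3 * √3 / 2) * y ^ 2) * ((K : ℝ) + 1) ^ 2 := by
        have e : (s - 4 * y / ((K : ℝ) + 1)) ^ 2 * ((K : ℝ) + 1) ^ 2 = (((K + 1 : ℕ) : ℝ) * s - 4 * y) ^ 2 := by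
          push_cast; field_simp
        rw [e]
        refine h1.trans ?_
        have := mul_le_mul_of_nonneg_right hQ (show 0 ≤ (3 * √3 / 2) * y ^ 2 by positivity)
        linarith
      exact le_of_mul_le_mul_right h2 (by positivity)
    · rintro z ⟨z1, z2⟩ ⟨z3, z4⟩
      obtain ⟨i, hi, hi1, hi2⟩ := cdb_index s K (z.1 - o) (by linarith) (by linarith)
      obtain ⟨j, hj, hj1, hj2⟩ := cdb_index s K (z.2 - o) (by linarith) (by linarith)
      obtain ⟨p, hp, hpz⟩ := hP (z.1 - i * s, z.2 - j * s) ⟨by simp only; linarith, by simp only; linarith⟩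
        ⟨by simp only; linarith, by simp only; linarith⟩
      refine ⟨(p.1 + i * s, p.2 + j * s), ?_, ?_⟩
      · rw [Finset.mem_image]
        refine ⟨(p, (i, j)), ?_, rfl⟩
        simp only [Finset.mem_product, Finset.mem_range]
        exact ⟨hp, hi, hj⟩
      · simp only [cdbD] at hpz ⊢
        calc _ = _ := by ring
          _ ≤ _ := hpz
  have hlim : Filter.Tendsto (fun K : ℕ => (s - 4 * y / ((K : ℝ) + 1)) ^ 2) Filter.atTop (nhds ((s - 0) ^ 2)) := by
    apply Filter.Tendsto.pow
    apply Filter.Tendsto.sub tendsto_const_nhds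
    have := (tendsto_one_div_add_atTop_nhds_zero_nat (𝕜 := ℝ)).const_mul (4 * y)
    simpa [div_eq_mul_inv] using this
  rw [sub_zero] at hlim
  refine le_of_tendsto hlim ?_
  obtain ⟨n, hn⟩ := exists_nat_ge (4 * y / s)
  filter_upwards [Filter.eventually_ge_atTop n] with K hK
  apply key
  rw [← div_le_iff₀ hs]
  have : (n : ℝ) ≤ K := by exact_mod_cast hK
  push_cast
  linarith

theorem covering_density_bound
    (y : ℝ) (hy0 : 0 < y) (hy1 : y < 1 / 2)
    (C : Finset (EuclideanSpace ℝ (Fin 2))) (hC : 2 ≤ C.card)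
    (hcover : {q : EuclideanSpace ℝ (Fin 2) | ∀ j : Fin 2, q j ∈ Set.Icc (y / 2) (1 - y / 2)} ⊆
      ⋃ c ∈ C, Metric.closedBall c y) :
    (2 * π / Real.sqrt 27) * (1 - y) ^ 2 ≤ (C.card : ℝ) * π * y ^ 2 ∧
      (2 / Real.sqrt 27) * (1 - y) ^ 2 / y ^ 2 ≤ (C.card : ℝ) := by
  classical
  let P : Finset (ℝ × ℝ) := C.image fun c => (c 0, c 1)
  have hmain := cdb_tile P y (y / 2) (1 - y) hy0 (by linarith) ?_
  · have hPC : (P.card : ℝ) ≤ C.card := by exact_mod_cast Finset.card_image_le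
    have h3 : √3 * √3 = 3 := Real.mul_self_sqrt (by norm_num)
    have hs : (0 : ℝ) < √3 := by positivity
    have h27 : √27 = 3 * √3 := by
      rw [show (27 : ℝ) = 3 ^ 2 * 3 by norm_num, Real.sqrt_mul (by norm_num), Real.sqrt_sq (by norm_num)]
    have hm : (1 - y) ^ 2 ≤ (C.card : ℝ) * (3 * √3 / 2) * y ^ 2 := by
      refine hmain.trans ?_
      gcongr
    have hkey : (2 / √27) * (1 - y) ^ 2 ≤ (C.card : ℝ) * y ^ 2 := by
      rw [h27, div_mul_eq_mul_div, div_le_iff₀ (by positivity)]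
      linarith
    constructor
    · have := mul_le_mul_of_nonneg_left hkey Real.pi_pos.le
      calc _ = π * ((2 / √27) * (1 - y) ^ 2) := by ring
        _ ≤ _ := this
        _ = _ := by ring
    · rw [div_le_iff₀ (by positivity)]
      exact hkey
  · rintro z ⟨z1, z2⟩ ⟨z3, z4⟩
    have hq : (!₂[z.1, z.2] : EuclideanSpace ℝ (Fin 2)) ∈
        {q : EuclideanSpace ℝ (Fin 2) | ∀ j : Fin 2, q j ∈ Set.Icc (y / 2) (1 - y / 2)} := by
      intro j
      fin_cases j
      · exact ⟨by simpa using z1, by simp; linarith⟩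
      · exact ⟨by simpa using z3, by simp; linarith⟩
    have := hcover hq
    simp only [Set.mem_iUnion, Metric.mem_closedBall] at this
    obtain ⟨c, hc, hd⟩ := this
    refine ⟨(c 0, c 1), Finset.mem_image_of_mem _ hc, ?_⟩
    rw [EuclideanSpace.dist_eq, Real.sqrt_le_left hy0.le, Fin.sum_univ_two] at hd
    simp only [Real.dist_eq, sq_abs] at hd
    simp at hd
    simp only [cdbD]
    linarith [sub_sq_comm z.1 (c 0), sub_sq_comm z.2 (c 1)]
end

section
/- There exists N₀ such that the following holds for all integers n ≥ N₀. Let k be an integer with 3·10⁵ ≤ k ≤ n/(10⁵ · ln n), let X₁, …, Xₙ be independent random points, each uniformly distributed in the unit square [0,1]² ⊆ ℝ², and set c₁ = 0.995^{3/2} · √3 · (4/27)^{1/4}. Then with probability at least 1 − 1/n, the points X₁, …, Xₙ are pairwise distinct and the k-dispersion value of the random point set P = {X₁, …, Xₙ} satisfies 0.99 · disp(P,k) ≤ c₁/√k ≤ disp(P,k). In particular, with probability at least 1 − 1/n any k-element subset of P whose pairwise distances are all at least c₁/√k is a 0.99-approximation to the k-dispersion problem on P. -/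
open Real MeasureTheory ENNReal
open scoped Classical

/-- The minimum inter-point distance of a finite point set (with at least two points,
the infimum is attained). -/
noncomputable def minDist {d : ℕ} (S : Finset (EuclideanSpace ℝ (Fin d))) : ℝ :=
  sInf {r : ℝ | ∃ p ∈ S, ∃ q ∈ S, p ≠ q ∧ r = dist p q}

/-- The `k`-dispersion value of a finite point set `P`: the maximum of `minDist S`
over all `k`-element subsets `S ⊆ P`. -/
noncomputable def disp {d : ℕ} (P : Finset (EuclideanSpace ℝ (Fin d))) (k : ℕ) : ℝ :=
  sSup {r : ℝ | ∃ S ⊆ P, S.card = k ∧ r = minDist S}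

/-- The unit square `[0,1]²` in the Euclidean plane. -/
def unitSquare : Set (EuclideanSpace ℝ (Fin 2)) :=
  {p | ∀ j : Fin 2, p j ∈ Set.Icc (0 : ℝ) 1}

/-- The uniform (probability) distribution on the unit square: two-dimensional
Lebesgue measure restricted to `[0,1]²`. -/
noncomputable def unifSquare : Measure (EuclideanSpace ℝ (Fin 2)) :=
  volume.restrict unitSquare

lemma sector_vol (R h : ℝ) (hR : 0 < R) (h0 : 0 < h) (hh : h < R) :
    volume {z : ℂ | ‖z‖ < R ∧ h * ‖z‖ < R * z.re} ≤ ENNReal.ofReal (Real.arccos (h / R) * R ^ 2) := by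
  set α := Real.arccos (h / R) with hα
  have hα0 : 0 ≤ α := Real.arccos_nonneg _
  have hm : MeasurableSet {z : ℂ | ‖z‖ < R ∧ h * ‖z‖ < R * z.re} := by
    apply IsOpen.measurableSet
    exact (isOpen_lt (f := fun z : ℂ => ‖z‖) (g := fun _ => R) (by fun_prop) (by fun_prop)).inter
      (isOpen_lt (f := fun z : ℂ => h * ‖z‖) (g := fun z => R * z.re) (by fun_prop) (by fun_prop))
  rw [← lintegral_indicator_one hm, ← Complex.lintegral_comp_polarCoord_symm]
  calc _ ≤ ∫⁻ p in polarCoord.target, (Set.Ioo 0 R ×ˢ Set.Ioo (-α) α).indicator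
        (fun p : ℝ × ℝ => ENNReal.ofReal p.1) p := by
        apply setLIntegral_mono' polarCoord.open_target.measurableSet
        rintro ⟨r, θ⟩ hp
        simp only [polarCoord_target, Set.mem_prod, Set.mem_Ioi, Set.mem_Ioo] at hp
        obtain ⟨hr, hθ⟩ := hp
        by_cases hz : Complex.polarCoord.symm (r, θ) ∈ {z : ℂ | ‖z‖ < R ∧ h * ‖z‖ < R * z.re}
        · have hz' := hz
          rw [Set.mem_ofPred_eq, Complex.norm_polarCoord_symm, Complex.polarCoord_symm_apply, abs_of_pos hr] at hz'
          simp only [] at hz'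
          have e : ((r:ℂ) * (↑(Real.cos θ) + ↑(Real.sin θ) * Complex.I)).re = r * Real.cos θ := by
            simp only [Complex.mul_re, Complex.add_re, Complex.ofReal_re, Complex.ofReal_im, Complex.I_re, Complex.I_im]; ring
          rw [e] at hz'
          have h1 : h / R < Real.cos θ := by
            rw [div_lt_iff₀ hR]
            nlinarith [hz'.2]
          have h2 : |θ| < α := by
            by_contra hc
            push Not at hc
            have := Real.cos_le_cos_of_nonneg_of_le_pi hα0 (abs_le.2 ⟨hθ.1.le, hθ.2.le⟩) hc
            rw [Real.cos_abs, hα, Real.cos_arccos] at this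
            · linarith
            · have := div_pos h0 hR; linarith
            · rw [div_le_one hR]; exact hh.le
          rw [Set.indicator_of_mem hz, Set.indicator_of_mem]
          · simp
          · exact ⟨⟨hr, hz'.1⟩, abs_lt.1 h2⟩
        · rw [Set.indicator_of_notMem hz]; simp
    _ ≤ ∫⁻ p, (Set.Ioo 0 R ×ˢ Set.Ioo (-α) α).indicator
        (fun p : ℝ × ℝ => ENNReal.ofReal p.1) p := setLIntegral_le_lintegral _ _
    _ = ∫⁻ p in (Set.Ioo 0 R ×ˢ Set.Ioo (-α) α),  ENNReal.ofReal p.1 ∂((volume : Measure ℝ).prod (volume : Measure ℝ)) := by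
        rw [lintegral_indicator (measurableSet_Ioo.prod measurableSet_Ioo)]; rfl
    _ = (∫⁻ r in Set.Ioo 0 R, ENNReal.ofReal r) * ENNReal.ofReal (2 * α) := by
        rw [← Measure.prod_restrict]
        have := lintegral_prod_mul (μ := volume.restrict (Set.Ioo 0 R)) (ν := volume.restrict (Set.Ioo (-α) α)) (f := fun r => ENNReal.ofReal r) (g := fun _ => 1) (by fun_prop) (by fun_prop)
        simp only [mul_one] at this
        rw [this]
        simp only [lintegral_const, MeasurableSet.univ, Measure.restrict_apply, Set.univ_inter, Real.volume_Ioo, one_mul]; congr 2; ring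
    _ = _ := by
        rw [← ofReal_integral_eq_lintegral_ofReal]
        · rw [← integral_Ioc_eq_integral_Ioo, ← intervalIntegral.integral_of_le hR.le, integral_id, ← ENNReal.ofReal_mul (by nlinarith)]
          congr 1; ring
        · exact (continuous_id.integrableOn_Icc (a := 0) (b := R)).mono_set Set.Ioo_subset_Icc_self
        · filter_upwards [ae_restrict_mem measurableSet_Ioo] with x hx using hx.1.le

lemma triangle_vol (R h : ℝ) (hR : 0 < R) (h0 : 0 < h) (hh : h < R) :
    ENNReal.ofReal (h * √(R ^ 2 - h ^ 2)) ≤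
    volume {z : ℂ | h * ‖z‖ < R * z.re ∧ z.re < h} := by
  set t := √(R ^ 2 - h ^ 2) / h with ht
  have hs : 0 < √(R ^ 2 - h ^ 2) := Real.sqrt_pos.2 (by nlinarith)
  have ht0 : 0 < t := by positivity
  have e : volume (regionBetween (fun x : ℝ => - (t * x)) (fun x => t * x) (Set.Ioo 0 h)) = ENNReal.ofReal (h * √(R ^ 2 - h ^ 2)) := by
    rw [show (volume : Measure (ℝ × ℝ)) = (volume : Measure ℝ).prod volume from rfl]
    rw [volume_regionBetween_eq_integral]
    · rw [← integral_Ioc_eq_integral_Ioo, ← intervalIntegral.integral_of_le h0.le]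
      congr 1
      have : (fun y : ℝ => ((fun x => t * x) - fun x => -(t * x)) y) = fun y => (2 * t) * y := by
        ext y; simp; ring
      rw [this, intervalIntegral.integral_const_mul, integral_id, ht]; field_simp; ring
    · exact ((by fun_prop : Continuous (fun x : ℝ => - (t * x))).integrableOn_Icc (a := 0) (b := h)).mono_set Set.Ioo_subset_Icc_self
    · exact ((by fun_prop : Continuous (fun x : ℝ => (t * x))).integrableOn_Icc (a := 0) (b := h)).mono_set Set.Ioo_subset_Icc_self
    · exact measurableSet_Ioo
    · intro x hx; have := mul_pos ht0 hx.1; show -(t * x) ≤ t * x; linarith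
  rw [← e, ← Complex.volume_preserving_equiv_real_prod.measure_preimage_equiv]
  apply measure_mono
  intro z hz
  simp only [Set.mem_preimage, Complex.measurableEquivRealProd_apply, regionBetween, Set.mem_ofPred_eq, Set.mem_Ioo] at hz
  obtain ⟨⟨hx0, hxh⟩, hy1, hy2⟩ := hz
  refine ⟨?_, hxh⟩
  have hy : z.im ^ 2 < (t * z.re) ^ 2 := sq_lt_sq' hy1 hy2
  have hts : t ^ 2 * h ^ 2 = R ^ 2 - h ^ 2 := by
    rw [ht, div_pow, Real.sq_sqrt (by nlinarith)]; field_simp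
  have hn : ‖z‖ ^ 2 = z.re ^ 2 + z.im ^ 2 := by
    rw [← Complex.normSq_eq_norm_sq, Complex.normSq_apply]; ring
  apply lt_of_pow_lt_pow_left₀ 2 (by positivity)
  rw [mul_pow, hn, mul_pow]
  have : h ^ 2 * z.im ^ 2 < h ^ 2 * (t * z.re) ^ 2 := by gcongr
  nlinarith

lemma sector_ratio (R h : ℝ) (hR : 0 < R) (h0 : √3 / 2 * R ≤ h) :
    ENNReal.ofReal (3 * √3 / (2 * π)) * volume {z : ℂ | ‖z‖ < R ∧ h * ‖z‖ < R * z.re} ≤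
    volume {z : ℂ | h * ‖z‖ < R * z.re ∧ z.re < h} := by
  have hh0 : 0 < h := lt_of_lt_of_le (by positivity) h0
  by_cases hh : R ≤ h
  · have : {z : ℂ | ‖z‖ < R ∧ h * ‖z‖ < R * z.re} = ∅ := by
      ext z
      simp only [Set.mem_ofPred_eq, Set.mem_empty_iff_false, iff_false, not_and, not_lt]
      intro _
      have := Complex.re_le_norm z
      have := norm_nonneg z
      nlinarith
    rw [this]; simp
  push Not at hh
  refine le_trans (mul_le_mul_right (sector_vol R h hR hh0 hh) _) (le_trans ?_ (triangle_vol R h hR hh0 hh))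
  rw [← ENNReal.ofReal_mul (by positivity)]
  apply ENNReal.ofReal_le_ofReal
  set α := Real.arccos (h / R) with hα
  have hc : Real.cos α = h / R := Real.cos_arccos (by have := div_pos hh0 hR; linarith) (by rw [div_le_one hR]; exact hh.le)
  have hs : Real.sin α = √(R ^ 2 - h ^ 2) / R := by
    rw [hα, Real.sin_arccos, eq_div_iff hR.ne', ← Real.sqrt_sq hR.le, ← Real.sqrt_mul' _ (by positivity), Real.sqrt_sq hR.le]
    congr 1; field_simp
  have hα0 : 0 ≤ α := Real.arccos_nonneg _
  have hα1 : α ≤ π / 6 := by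
    rw [← Real.arccos_cos (x := π / 6) (by positivity) (by linarith [Real.pi_pos]), Real.cos_pi_div_six]
    apply Real.arccos_le_arccos
    rw [le_div_iff₀ hR]; exact h0
  have key : 3 * √3 / (2 * π) * (2 * α) ≤ Real.sin (2 * α) := by
    have := strictConcaveOn_sin_Icc.concaveOn.2 (⟨le_rfl, pi_pos.le⟩ : (0:ℝ) ∈ Set.Icc 0 π) (⟨by positivity, by linarith [pi_pos]⟩ : π / 3 ∈ Set.Icc 0 π)
      (show 0 ≤ 1 - 6 * α / π from by rw [sub_nonneg, div_le_one pi_pos]; linarith) (show 0 ≤ 6 * α / π by positivity) (by ring)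
    simp only [smul_eq_mul, Real.sin_zero, mul_zero, zero_add, Real.sin_pi_div_three] at this
    have e1 : 6 * α / π * (π / 3) = 2 * α := by field_simp; ring
    rw [e1] at this
    refine le_trans (le_of_eq ?_) this
    field_simp; ring
  rw [Real.sin_two_mul, hs, hc] at key
  have : h * √(R ^ 2 - h ^ 2) = R ^ 2 * (√(R ^ 2 - h ^ 2) / R * (h / R)) := by field_simp
  rw [this]
  nlinarith [sq_nonneg R, mul_le_mul_of_nonneg_left key (sq_nonneg R)]

def secS (R : ℝ) (q : ℂ) : Set ℂ :=
  {z | ‖z‖ < R ∧ ‖q‖ ^ 2 * ‖z‖ < 2 * R * (z * (starRingEnd ℂ) q).re}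

def secT (R : ℝ) (q : ℂ) : Set ℂ :=
  {z | ‖q‖ ^ 2 * ‖z‖ < 2 * R * (z * (starRingEnd ℂ) q).re ∧ 2 * (z * (starRingEnd ℂ) q).re < ‖q‖ ^ 2}

lemma secS_open (R : ℝ) (q : ℂ) : IsOpen (secS R q) :=
  (isOpen_lt (f := fun z : ℂ => ‖z‖) (g := fun _ => R) (by fun_prop) (by fun_prop)).inter
    (isOpen_lt (f := fun z : ℂ => ‖q‖ ^ 2 * ‖z‖) (g := fun z => 2 * R * (z * (starRingEnd ℂ) q).re)
      (by fun_prop) (Continuous.mul (by fun_prop) (Complex.continuous_re.comp (by fun_prop))))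

lemma secT_open (R : ℝ) (q : ℂ) : IsOpen (secT R q) :=
  (isOpen_lt (f := fun z : ℂ => ‖q‖ ^ 2 * ‖z‖) (g := fun z => 2 * R * (z * (starRingEnd ℂ) q).re)
      (by fun_prop) (Continuous.mul (by fun_prop) (Complex.continuous_re.comp (by fun_prop)))).inter
   (isOpen_lt (f := fun z : ℂ => 2 * (z * (starRingEnd ℂ) q).re) (g := fun _ => ‖q‖ ^ 2)
      (Continuous.mul (by fun_prop) (Complex.continuous_re.comp (by fun_prop))) (by fun_prop))

lemma sector_ratio_gen (R : ℝ) (hR : 0 < R) (q : ℂ) (hq : √3 * R ≤ ‖q‖) :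
    ENNReal.ofReal (3 * √3 / (2 * π)) * volume (secS R q) ≤ volume (secT R q) := by
  have hq0 : 0 < ‖q‖ := lt_of_lt_of_le (by positivity) hq
  have hqne : q ≠ 0 := norm_pos_iff.1 hq0
  have hu : ‖q / ‖q‖‖ = 1 := by
    rw [norm_div]; simp [hqne]
  let u : Circle := ⟨q / ‖q‖, by simpa [Submonoid.unitSphere] using hu⟩
  have hmp := (rotation u).measurePreserving
  have hre : ∀ z : ℂ, ((rotation u z) * (starRingEnd ℂ) q).re = ‖q‖ * z.re := by
    intro z
    have : (rotation u z) * (starRingEnd ℂ) q = ((‖q‖ : ℝ) : ℂ) * z := by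
      rw [rotation_apply]
      show q / ‖q‖ * z * (starRingEnd ℂ) q = _
      have : q * (starRingEnd ℂ) q = (‖q‖ : ℂ) ^ 2 := by rw [Complex.mul_conj, Complex.normSq_eq_norm_sq]; push_cast; rfl
      have h3 : (‖q‖ : ℂ) ≠ 0 := by exact_mod_cast hq0.ne'
      rw [show q / ‖q‖ * z * (starRingEnd ℂ) q = (q * (starRingEnd ℂ) q) * z / ‖q‖ by ring, this]
      field_simp
    rw [this]; simp
  have hn : ∀ z : ℂ, ‖rotation u z‖ = ‖z‖ := fun z => (rotation u).norm_map z
  rw [← hmp.measure_preimage (secS_open R q).measurableSet.nullMeasurableSet,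
    ← hmp.measure_preimage (secT_open R q).measurableSet.nullMeasurableSet]
  have key : ∀ z : ℂ, ‖q‖ ^ 2 * ‖z‖ < 2 * R * (‖q‖ * z.re) ↔ ‖q‖ / 2 * ‖z‖ < R * z.re := by
    intro z
    rw [show ‖q‖ ^ 2 * ‖z‖ = (2 * ‖q‖) * (‖q‖ / 2 * ‖z‖) by ring, show 2 * R * (‖q‖ * z.re) = (2 * ‖q‖) * (R * z.re) by ring]
    exact mul_lt_mul_iff_right₀ (by positivity)
  have key2 : ∀ z : ℂ, 2 * (‖q‖ * z.re) < ‖q‖ ^ 2 ↔ z.re < ‖q‖ / 2 := by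
    intro z
    rw [show ‖q‖ ^ 2 = (2 * ‖q‖) * (‖q‖ / 2) by ring, show 2 * (‖q‖ * z.re) = (2 * ‖q‖) * (z.re) by ring]
    exact mul_lt_mul_iff_right₀ (by positivity)
  have e1 : (rotation u) ⁻¹' secS R q = {z : ℂ | ‖z‖ < R ∧ ‖q‖ / 2 * ‖z‖ < R * z.re} := by
    ext z
    simp only [secS, Set.mem_preimage, Set.mem_ofPred_eq, hn, hre, key]
  have e2 : (rotation u) ⁻¹' secT R q = {z : ℂ | ‖q‖ / 2 * ‖z‖ < R * z.re ∧ z.re < ‖q‖ / 2} := by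
    ext z
    simp only [secT, Set.mem_preimage, Set.mem_ofPred_eq, hn, hre, key, key2]
  rw [e1, e2]
  exact sector_ratio R _ hR (by linarith)

lemma norm_sub_sq_c (z q : ℂ) : ‖z - q‖ ^ 2 = ‖z‖ ^ 2 - 2 * (z * (starRingEnd ℂ) q).re + ‖q‖ ^ 2 := by
  simp only [← Complex.normSq_eq_norm_sq, Complex.normSq_apply, Complex.sub_re, Complex.sub_im, Complex.mul_re, Complex.conj_re, Complex.conj_im]
  ring

lemma secT_sub (R : ℝ) (hR : 0 < R) (q : ℂ) : secT R q ⊆ secS R q := by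
  rintro z ⟨h1, h2⟩
  refine ⟨?_, h1⟩
  by_contra hc
  push Not at hc
  nlinarith [sq_nonneg ‖q‖, mul_le_mul_of_nonneg_left hc (sq_nonneg ‖q‖)]

lemma cap_sub (R : ℝ) (hR : 0 < R) (q z : ℂ) (hq : q ≠ 0) (hz : ‖z‖ < R) (hc : ‖z - q‖ ≤ ‖z‖) : z ∈ secS R q := by
  refine ⟨hz, ?_⟩
  have h1 : ‖z - q‖ ^ 2 ≤ ‖z‖ ^ 2 := by gcongr
  rw [norm_sub_sq_c] at h1
  have : 0 < ‖q‖ := norm_pos_iff.2 hq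
  have : ‖q‖ ^ 2 * ‖z‖ < ‖q‖ ^ 2 * R := by gcongr
  nlinarith

lemma secS_disj (R : ℝ) (hR : 0 < R) (q q' : ℂ) (hq : √3 * R ≤ ‖q‖) (hq' : √3 * R ≤ ‖q'‖)
    (hqq : √3 * R ≤ ‖q - q'‖) : Disjoint (secS R q) (secS R q') := by
  rw [Set.disjoint_left]
  rintro z ⟨hz, h1⟩ ⟨_, h2⟩
  have hz0 : 0 < ‖z‖ := by
    by_contra hc
    have : z = 0 := norm_le_zero_iff.1 (not_lt.1 hc)
    subst this
    simp at h1
  have h3 := Real.sq_sqrt (show (0:ℝ) ≤ 3 by norm_num)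
  have a1 : 3 * R ^ 2 ≤ ‖q‖ ^ 2 := by rw [← h3, ← mul_pow]; gcongr
  have a2 : 3 * R ^ 2 ≤ ‖q'‖ ^ 2 := by rw [← h3, ← mul_pow]; gcongr
  have a3 : 3 * R ^ 2 ≤ ‖q - q'‖ ^ 2 := by rw [← h3, ← mul_pow]; gcongr
  -- scaled point
  set t := R / ‖z‖ with ht
  have ht0 : 0 < t := by positivity
  have htz : t * ‖z‖ = R := by rw [ht]; field_simp
  have b1 : ‖q‖ ^ 2 < 2 * (t * (z * (starRingEnd ℂ) q).re) := by
    have := mul_lt_mul_of_pos_left h1 ht0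
    nlinarith
  have b2 : ‖q'‖ ^ 2 < 2 * (t * (z * (starRingEnd ℂ) q').re) := by
    have := mul_lt_mul_of_pos_left h2 ht0
    nlinarith
  have b3 : t ^ 2 * ‖z‖ ^ 2 = R ^ 2 := by rw [← mul_pow, htz]
  simp only [← Complex.normSq_eq_norm_sq, Complex.normSq_apply, Complex.sub_re, Complex.sub_im, Complex.mul_re, Complex.conj_re, Complex.conj_im] at *
  nlinarith [sq_nonneg (q.re + q'.re - 3 * (t * z.re)), sq_nonneg (q.im + q'.im - 3 * (t * z.im))]

lemma cell_vol (R : ℝ) (hR : 0 < R) (S : Finset ℂ) (hS : ∀ q ∈ S, √3 * R ≤ ‖q‖)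
    (hSS : ∀ q ∈ S, ∀ q' ∈ S, q ≠ q' → √3 * R ≤ ‖q - q'‖) :
    ENNReal.ofReal (3 * √3 / 2 * R ^ 2) ≤ volume {z : ℂ | ‖z‖ < R ∧ ∀ q ∈ S, ‖z‖ < ‖z - q‖} := by
  have hne : ∀ q ∈ S, q ≠ 0 := fun q hq => norm_pos_iff.1 (lt_of_lt_of_le (by positivity) (hS q hq))
  set U : Set ℂ := ⋃ q ∈ S, secS R q with hU
  set c := ENNReal.ofReal (3 * √3 / (2 * π)) with hc
  have hc1 : c ≤ 1 := by
    rw [hc, ← ENNReal.ofReal_one]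
    apply ENNReal.ofReal_le_ofReal
    rw [div_le_one (by positivity)]
    have : √3 ≤ 2 := by rw [Real.sqrt_le_left (by norm_num)]; norm_num
    linarith [Real.pi_gt_three]
  have hUo : IsOpen U := isOpen_biUnion fun q _ => secS_open R q
  have hpd : (S : Set ℂ).PairwiseDisjoint (secS R) := fun q hq q' hq' hqq =>
    secS_disj R hR q q' (hS q hq) (hS q' hq') (hSS q hq q' hq' hqq)
  have hball : ENNReal.ofReal (3 * √3 / 2 * R ^ 2) = c * volume (Metric.ball (0:ℂ) R) := by
    rw [Complex.volume_ball, hc, ← ENNReal.ofReal_coe_nnreal, ← ENNReal.ofReal_pow hR.le, ← ENNReal.ofReal_mul (by positivity),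
      ← ENNReal.ofReal_mul (by positivity)]
    congr 1
    simp only [NNReal.coe_real_pi]
    field_simp
  have hTd : Disjoint (⋃ q ∈ S, secT R q) (Metric.ball (0:ℂ) R \ U) := by
    apply Set.disjoint_sdiff_right.mono_left
    exact Set.biUnion_mono (fun _ h => h) (fun q _ => secT_sub R hR q)
  calc _ = c * volume (Metric.ball (0:ℂ) R) := hball
    _ ≤ c * (volume U + volume (Metric.ball (0:ℂ) R \ U)) := by
        gcongr
        refine (measure_mono ?_).trans (measure_union_le _ _)
        intro z hz
        by_cases h : z ∈ U
        · exact Or.inl h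
        · exact Or.inr ⟨hz, h⟩
    _ = c * volume U + c * volume (Metric.ball (0:ℂ) R \ U) := mul_add _ _ _
    _ ≤ volume (⋃ q ∈ S, secT R q) + volume (Metric.ball (0:ℂ) R \ U) := by
        gcongr
        · rw [hU, measure_biUnion_finset hpd (fun q _ => (secS_open R q).measurableSet),
            measure_biUnion_finset (fun q hq q' hq' hqq => (hpd hq hq' hqq).mono (secT_sub R hR q) (secT_sub R hR q')) (fun q _ => (secT_open R q).measurableSet), Finset.mul_sum]
          exact Finset.sum_le_sum fun q hq => sector_ratio_gen R hR q (hS q hq)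
        · calc _ ≤ 1 * volume (Metric.ball (0:ℂ) R \ U) := by gcongr
            _ = _ := one_mul _
    _ = volume ((⋃ q ∈ S, secT R q) ∪ (Metric.ball (0:ℂ) R \ U)) := 
        (measure_union hTd (Metric.isOpen_ball.measurableSet.diff hUo.measurableSet)).symm
    _ ≤ _ := by
        apply measure_mono
        rintro z (hz | ⟨hz, hzU⟩)
        · simp only [Set.mem_iUnion] at hz
          obtain ⟨q, hq, hz⟩ := hz
          have hzS := secT_sub R hR q hz
          refine ⟨hzS.1, fun q' hq' => ?_⟩
          by_contra hcon
          push Not at hcon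
          by_cases hqq : q' = q
          · subst hqq
            have h1 : ‖z - q'‖ ^ 2 ≤ ‖z‖ ^ 2 := by gcongr
            rw [norm_sub_sq_c] at h1
            have := hz.2
            linarith
          · exact Set.disjoint_left.1 (hpd hq' hq hqq) (cap_sub R hR q' z (hne q' hq') hzS.1 hcon) hzS
        · have hz' : ‖z‖ < R := by simpa using hz
          refine ⟨hz', fun q' hq' => ?_⟩
          by_contra hcon
          push Not at hcon
          apply hzU
          simp only [hU, Set.mem_iUnion]
          exact ⟨q', hq', cap_sub R hR q' z (hne q' hq') hz' hcon⟩

lemma packing_complex (R : ℝ) (hR : 0 < R) (S : Finset ℂ)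
    (hsq : ∀ p ∈ S, p.re ∈ Set.Icc (0:ℝ) 1 ∧ p.im ∈ Set.Icc (0:ℝ) 1)
    (hSS : ∀ q ∈ S, ∀ q' ∈ S, q ≠ q' → √3 * R ≤ ‖q - q'‖) :
    (S.card : ℝ) * (3 * √3 / 2 * R ^ 2) ≤ (1 + 2 * R) ^ 2 := by
  let V : ℂ → Set ℂ := fun p => {z | ‖z - p‖ < R ∧ ∀ q ∈ S.erase p, ‖z - p‖ < ‖z - q‖}
  have hVo : ∀ p, IsOpen (V p) := by
    intro p
    have : V p = {z | ‖z - p‖ < R} ∩ ⋂ q ∈ S.erase p, {z | ‖z - p‖ < ‖z - q‖} := by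
      ext z; simp only [V, Set.mem_ofPred_eq, Set.mem_inter_iff, Set.mem_iInter]
    rw [this]
    refine (isOpen_lt (f := fun z : ℂ => ‖z - p‖) (g := fun _ => R) (by fun_prop) (by fun_prop)).inter ?_
    exact isOpen_biInter_finset fun q _ => isOpen_lt (f := fun z : ℂ => ‖z - p‖) (g := fun z => ‖z - q‖) (by fun_prop) (by fun_prop)
  have hVvol : ∀ p ∈ S, ENNReal.ofReal (3 * √3 / 2 * R ^ 2) ≤ volume (V p) := by
    intro p hp
    have h := cell_vol R hR ((S.erase p).image (fun q => q - p)) (by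
      intro q hq
      obtain ⟨q, hq1, rfl⟩ := Finset.mem_image.1 hq
      exact hSS q (Finset.mem_of_mem_erase hq1) p hp (Finset.ne_of_mem_erase hq1)) (by
      intro q hq q' hq' hne
      obtain ⟨q, hq1, rfl⟩ := Finset.mem_image.1 hq
      obtain ⟨q', hq1', rfl⟩ := Finset.mem_image.1 hq'
      rw [sub_sub_sub_cancel_right]
      exact hSS q (Finset.mem_of_mem_erase hq1) q' (Finset.mem_of_mem_erase hq1') (fun h => hne (by rw [h])))
    refine h.trans (le_of_eq ?_)
    rw [← measure_preimage_add_right volume p (V p)]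
    congr 1
    ext z
    simp only [V, Set.mem_preimage, Set.mem_ofPred_eq, add_sub_cancel_right, Finset.forall_mem_image]
    refine and_congr Iff.rfl (forall₂_congr fun q _ => ?_)
    rw [show z - (q - p) = z + p - q by ring]
  have hVd : (S : Set ℂ).PairwiseDisjoint V := by
    intro p hp q hq hpq
    rw [Function.onFun, Set.disjoint_left]
    rintro z ⟨_, h1⟩ ⟨_, h2⟩
    have := h1 q (Finset.mem_erase.2 ⟨hpq.symm, hq⟩)
    have := h2 p (Finset.mem_erase.2 ⟨hpq, hp⟩)
    linarith
  have hbox : volume (Complex.measurableEquivRealProd ⁻¹' (Set.Ioo (-R) (1 + R) ×ˢ Set.Ioo (-R) (1 + R))) = ENNReal.ofReal ((1 + 2 * R) ^ 2) := by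
    rw [Complex.volume_preserving_equiv_real_prod.measure_preimage_equiv, Measure.volume_eq_prod, Measure.prod_prod, Real.volume_Ioo,
      ← ENNReal.ofReal_mul (by linarith)]
    congr 1; ring
  have hsub : (⋃ p ∈ S, V p) ⊆ (Complex.measurableEquivRealProd ⁻¹' (Set.Ioo (-R) (1 + R) ×ˢ Set.Ioo (-R) (1 + R))) := by
    intro z hz
    simp only [Set.mem_iUnion] at hz
    obtain ⟨p, hp, hz, _⟩ := hz
    obtain ⟨⟨h1, h2⟩, h3, h4⟩ := hsq p hp
    have hr := abs_lt.1 ((Complex.abs_re_le_norm (z - p)).trans_lt hz)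
    have hi := abs_lt.1 ((Complex.abs_im_le_norm (z - p)).trans_lt hz)
    simp only [Complex.sub_re, Complex.sub_im] at hr hi
    simp only [Set.mem_preimage, Complex.measurableEquivRealProd_apply, Set.mem_prod, Set.mem_Ioo]
    exact ⟨⟨by linarith, by linarith⟩, by linarith, by linarith⟩
  have h : ∑ p ∈ S, ENNReal.ofReal (3 * √3 / 2 * R ^ 2) ≤ ENNReal.ofReal ((1 + 2 * R) ^ 2) := by
    rw [← hbox]
    refine (Finset.sum_le_sum hVvol).trans ?_
    rw [← measure_biUnion_finset hVd fun p _ => (hVo p).measurableSet]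
    exact measure_mono hsub
  rw [Finset.sum_const, nsmul_eq_mul, ← ENNReal.ofReal_natCast, ← ENNReal.ofReal_mul (by positivity), ENNReal.ofReal_le_ofReal_iff (by positivity)] at h
  exact h

lemma packing (d : ℝ) (hd : 0 < d) (S : Finset (EuclideanSpace ℝ (Fin 2)))
    (hsq : ∀ p ∈ S, p ∈ unitSquare)
    (hSS : ∀ q ∈ S, ∀ q' ∈ S, q ≠ q' → d ≤ dist q q') :
    (S.card : ℝ) * (√3 / 2 * d ^ 2) ≤ (1 + 2 * (d / √3)) ^ 2 := by
  have h3 : (√3) ^ 2 = 3 := Real.sq_sqrt (by norm_num)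
  let L := Complex.orthonormalBasisOneI.repr
  have h := packing_complex (d / √3) (by positivity) (S.image L.symm) (by
    intro p hp
    obtain ⟨p, hp1, rfl⟩ := Finset.mem_image.1 hp
    have h := hsq p hp1
    have e : L (L.symm p) = p := L.apply_symm_apply p
    have e0 : (L.symm p).re = p 0 := by
      conv_rhs => rw [← e]
      simp [L, Complex.orthonormalBasisOneI_repr_apply]
    have e1 : (L.symm p).im = p 1 := by
      conv_rhs => rw [← e]
      simp [L, Complex.orthonormalBasisOneI_repr_apply]
    rw [e0, e1]
    exact ⟨h 0, h 1⟩) (by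
    intro q hq q' hq' hne
    obtain ⟨q, hq1, rfl⟩ := Finset.mem_image.1 hq
    obtain ⟨q', hq1', rfl⟩ := Finset.mem_image.1 hq'
    rw [← dist_eq_norm, LinearIsometryEquiv.dist_map, mul_div_cancel₀ _ (by positivity)]
    exact hSS q hq1 q' hq1' (fun h => hne (by rw [h])))
  rw [Finset.card_image_of_injective _ L.symm.injective] at h
  refine le_trans (le_of_eq ?_) h
  rw [div_pow, h3]; ring

lemma minDist_le {S : Finset (EuclideanSpace ℝ (Fin 2))} {p q : EuclideanSpace ℝ (Fin 2)} (hp : p ∈ S) (hq : q ∈ S) (h : p ≠ q) :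
    minDist S ≤ dist p q := by
  apply csInf_le
  · exact ⟨0, by rintro _ ⟨p, _, q, _, _, rfl⟩; exact dist_nonneg⟩
  · exact ⟨p, hp, q, hq, h, rfl⟩

lemma le_minDist {S : Finset (EuclideanSpace ℝ (Fin 2))} (hc : 2 ≤ S.card) {r : ℝ}
    (h : ∀ p ∈ S, ∀ q ∈ S, p ≠ q → r ≤ dist p q) : r ≤ minDist S := by
  apply le_csInf
  · obtain ⟨p, hp, q, hq, hpq⟩ := Finset.one_lt_card.1 (by omega : 1 < S.card)
    exact ⟨_, p, hp, q, hq, hpq, rfl⟩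
  · rintro _ ⟨p, hp, q, hq, hpq, rfl⟩; exact h p hp q hq hpq

lemma le_disp {P S : Finset (EuclideanSpace ℝ (Fin 2))} {k : ℕ} (hS : S ⊆ P) (hc : S.card = k) : minDist S ≤ disp P k := by
  apply le_csSup
  · apply Set.Finite.bddAbove
    apply ((P.powerset.finite_toSet).image minDist).subset
    rintro _ ⟨S, hS, _, rfl⟩
    exact ⟨S, by simpa using hS, rfl⟩
  · exact ⟨S, hS, hc, rfl⟩

noncomputable def cOne : ℝ := (0.995 : ℝ) ^ ((3 : ℝ) / 2) * Real.sqrt 3 * ((4 : ℝ) / 27) ^ ((1 : ℝ) / 4)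

lemma cOne_pos : 0 < cOne := by unfold cOne; positivity

lemma cOne_pow : cOne ^ 4 = 0.995 ^ 6 * (4 / 3) := by
  unfold cOne
  have h3 : (√3) ^ 4 = 9 := by
    rw [show (4:ℕ) = 2 * 2 by norm_num, pow_mul, Real.sq_sqrt (by norm_num)]; norm_num
  rw [mul_pow, mul_pow, h3, ← Real.rpow_natCast, ← Real.rpow_natCast, ← Real.rpow_mul (by norm_num), ← Real.rpow_mul (by norm_num)]
  rw [show (3:ℝ) / 2 * ((4:ℕ):ℝ) = ((6:ℕ):ℝ) by norm_num, show (1:ℝ) / 4 * ((4:ℕ):ℝ) = 1 by norm_num, Real.rpow_natCast, Real.rpow_one]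
  norm_num

lemma cOne_lt : cOne < 1.0666 := by
  apply lt_of_pow_lt_pow_left₀ 4 (by norm_num)
  rw [cOne_pow]; norm_num

lemma lt_cOne : 1.0665 < cOne := by
  apply lt_of_pow_lt_pow_left₀ 4 cOne_pos.le
  rw [cOne_pow]; norm_num

lemma sqrt_k_lb (k : ℕ) (hk : 3 * 10 ^ 5 ≤ k) : 547.7 ≤ √(k:ℝ) := by
  apply Real.le_sqrt_of_sq_le
  have h0 : 300000 ≤ k := by omega
  have : (300000 : ℝ) ≤ k := by exact_mod_cast h0
  norm_num
  linarith

lemma disp_upper (k : ℕ) (hk : 3 * 10 ^ 5 ≤ k) (P : Finset (EuclideanSpace ℝ (Fin 2)))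
    (hsq : ∀ p ∈ P, p ∈ unitSquare) : 0.99 * disp P k ≤ cOne / √k := by
  have hw := sqrt_k_lb k hk
  set w := √(k:ℝ) with hwd
  have hw2 : w ^ 2 = k := Real.sq_sqrt (by positivity)
  have hw0 : 0 < w := by linarith
  have : disp P k ≤ cOne / w / 0.99 := by
    apply Real.sSup_le
    · rintro _ ⟨S, hS, hc, rfl⟩
      by_contra hcon
      push Not at hcon
      have hpos : 0 < cOne / w / 0.99 := by have := cOne_pos; positivity
      set d := minDist S with hd
      have h := packing d (by linarith) S (fun p hp => hsq p (hS hp)) (fun p hp q hq h => minDist_le hp hq h)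
      rw [hc, ← hw2] at h
      set x := d * w with hx
      have hxl : 1.0772 < x := by
        rw [div_div, div_lt_iff₀ (by positivity)] at hcon
        have := lt_cOne
        norm_num at *
        nlinarith
      have h3 : (√3) ^ 2 = 3 := Real.sq_sqrt (by norm_num)
      have h3l : 1.73205 < √3 := by apply Real.lt_sqrt_of_sq_lt; norm_num
      have hd3 : 2 * (d / √3) ≤ 0.00211 * x := by
        rw [hx, ← mul_div_assoc, div_le_iff₀ (by positivity)]
        have : 2 ≤ 0.00211 * w * √3 := by nlinarith
        have hd0 : 0 < d := by linarith
        nlinarith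
      have hd0 : 0 ≤ 2 * (d / √3) := by have : 0 < d := by linarith
                                        positivity
      have h5 : (1 + 2 * (d / √3)) ^ 2 ≤ (1 + 0.00211 * x) ^ 2 := by gcongr
      have h6 : w ^ 2 * (√3 / 2 * d ^ 2) = √3 / 2 * x ^ 2 := by rw [hx]; ring
      rw [h6] at h
      have h7 : 0.866025 * x ^ 2 ≤ (1 + 0.00211 * x) ^ 2 := by nlinarith [sq_nonneg x]
      nlinarith
    · have := cOne_pos; positivity
  rw [le_div_iff₀ (by norm_num)] at this
  linarith

set_option maxHeartbeats 1000000 in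
lemma hex_grid (k : ℕ) (hk : 3 * 10 ^ 5 ≤ k) : ∃ cx cy : Fin k → ℝ,
    (∀ i, 0 ≤ cx i ∧ cx i + 0.0045 / √k ≤ 1 ∧ 0 ≤ cy i ∧ cy i + 0.0045 / √k ≤ 1) ∧
    ∀ i j, i ≠ j → (1.073 / √k) ^ 2 ≤ (cx i - cx j) ^ 2 + (cy i - cy j) ^ 2 := by
  have hw := sqrt_k_lb k hk
  set w := √(k:ℝ) with hwd
  have hw2 : w ^ 2 = k := Real.sq_sqrt (by positivity)
  have hw0 : 0 < w := by linarith
  set s := 1.073 / w with hs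
  set a := 0.0045 / w with ha
  have hs0 : 0 < s := by positivity
  have ha0 : 0 < a := by positivity
  have hsw : s * w = 1.073 := by rw [hs]; field_simp
  have haw : a * w = 0.0045 := by rw [ha]; field_simp
  have h3 : (√3) ^ 2 = 3 := Real.sq_sqrt (by norm_num)
  have h3p : 0 < √3 := by positivity
  have h3u : √3 < 1.7321 := by rw [Real.sqrt_lt' (by norm_num)]; norm_num
  have ha1 : a < 1 := by nlinarith
  set h := √3 / 2 * s with hh
  have hh0 : 0 < h := by positivity
  set M := ⌊(1 - a) / s + 1 / 2⌋₊ with hM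
  set J := ⌊(1 - a) / h⌋₊ + 1 with hJ
  have hM1 : (M : ℝ) ≤ (1 - a) / s + 1 / 2 := Nat.floor_le (by have : 0 ≤ (1 - a) / s := div_nonneg (by linarith) hs0.le
                                                               linarith)
  have hJ1 : (J : ℝ) - 1 ≤ (1 - a) / h := by
    have := Nat.floor_le (show 0 ≤ (1 - a) / h from div_nonneg (by linarith) hh0.le)
    rw [hJ]; push_cast; linarith
  have hM2 : (1 - a) / s - 1 / 2 ≤ M := by
    have := (Nat.lt_floor_add_one ((1 - a) / s + 1 / 2)).le
    linarith
  have hJ2 : (1 - a) / h ≤ J := by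
    have := (Nat.lt_floor_add_one ((1 - a) / h)).le
    rw [hJ]; push_cast; linarith
  have hM3 : 0.9318 * w - 0.6 ≤ M := by
    refine le_trans ?_ hM2
    rw [le_sub_iff_add_le, le_div_iff₀ hs0]
    nlinarith
  have hJ3 : 1.076 * w - 0.1 ≤ J := by
    refine le_trans ?_ hJ2
    rw [le_div_iff₀ hh0]
    have : h * w ≤ 0.86605 * 1.073 := by rw [hh, mul_assoc, hsw]; nlinarith
    nlinarith
  have hMJ : k ≤ M * J := by
    have : (k : ℝ) ≤ M * J := by
      rw [← hw2]
      have : (0.9318 * w - 0.6) * (1.076 * w - 0.1) ≤ M * J := by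
        apply mul_le_mul hM3 hJ3 (by linarith) (by linarith)
      nlinarith
    exact_mod_cast this
  have hcard : Fintype.card (Fin k) ≤ Fintype.card (Fin M × Fin J) := by simpa using hMJ
  obtain ⟨f⟩ := Function.Embedding.nonempty_of_card_le hcard
  let m : Fin M × Fin J → ℤ := fun p => 2 * (p.1.val : ℤ) + (p.2.val : ℤ) % 2
  let jj : Fin M × Fin J → ℤ := fun p => (p.2.val : ℤ)
  refine ⟨fun i => s / 2 * (m (f i) : ℝ), fun i => h * (jj (f i) : ℝ), ?_, ?_⟩
  · intro i
    have b1 : 0 ≤ m (f i) := by simp only [m]; omega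
    have b2 : m (f i) ≤ 2 * (M : ℤ) - 1 := by
      have := (f i).1.isLt
      simp only [m]; omega
    have b3 : 0 ≤ jj (f i) := by simp only [jj]; omega
    have b4 : jj (f i) ≤ (J : ℤ) - 1 := by
      have := (f i).2.isLt
      simp only [jj]; omega
    have b1' : (0:ℝ) ≤ m (f i) := by exact_mod_cast b1
    have b2' : (m (f i) : ℝ) ≤ 2 * M - 1 := by exact_mod_cast b2
    have b3' : (0:ℝ) ≤ jj (f i) := by exact_mod_cast b3
    have b4' : (jj (f i) : ℝ) ≤ J - 1 := by exact_mod_cast b4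
    refine ⟨by positivity, ?_, by positivity, ?_⟩
    · have : s / 2 * (m (f i) : ℝ) ≤ s * ((M:ℝ) - 1 / 2) := by
        calc _ ≤ s / 2 * (2 * M - 1) := by gcongr
          _ = _ := by ring
      have h2 : s * ((M:ℝ) - 1 / 2) ≤ s * ((1 - a) / s) := by gcongr; linarith
      rw [mul_div_cancel₀ _ hs0.ne'] at h2
      simp only; linarith
    · have h2 : h * (jj (f i) : ℝ) ≤ h * ((1 - a) / h) := by gcongr; linarith
      rw [mul_div_cancel₀ _ hh0.ne'] at h2
      simp only; linarith
  · intro i j hij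
    have hf : f i ≠ f j := fun hc => hij (f.injective hc)
    have key : 4 ≤ (m (f i) - m (f j)) ^ 2 + 3 * (jj (f i) - jj (f j)) ^ 2 := by
      generalize f i = p at *
      generalize f j = q at *
      by_cases hJe : p.2.val = q.2.val
      · have : p.1.val ≠ q.1.val := fun hc => hf (Prod.ext (Fin.ext hc) (Fin.ext hJe))
        have h4 : m p - m q ≤ -2 ∨ 2 ≤ m p - m q := by simp only [m]; omega
        rcases h4 with h4 | h4 <;> nlinarith [sq_nonneg (jj p - jj q)]
      · have h5 : jj p - jj q ≤ -1 ∨ 1 ≤ jj p - jj q := by simp only [jj]; omega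
        by_cases h6 : -1 ≤ jj p - jj q ∧ jj p - jj q ≤ 1
        · have h7 : m p - m q ≤ -1 ∨ 1 ≤ m p - m q := by simp only [m, jj] at *; omega
          have h8 : 1 ≤ (m p - m q) ^ 2 := by rcases h7 with h7 | h7 <;> nlinarith
          have h9 : 1 ≤ (jj p - jj q) ^ 2 := by rcases h5 with h7 | h7 <;> nlinarith
          linarith
        · have h7 : jj p - jj q ≤ -2 ∨ 2 ≤ jj p - jj q := by omega
          have h9 : 4 ≤ (jj p - jj q) ^ 2 := by rcases h7 with h7 | h7 <;> nlinarith
          nlinarith [sq_nonneg (m p - m q)]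
    have key' : (4:ℝ) ≤ ((m (f i) : ℝ) - m (f j)) ^ 2 + 3 * ((jj (f i) : ℝ) - jj (f j)) ^ 2 := by exact_mod_cast key
    have e : (s / 2 * (m (f i) : ℝ) - s / 2 * (m (f j) : ℝ)) ^ 2 + (h * (jj (f i) : ℝ) - h * (jj (f j) : ℝ)) ^ 2
      = s ^ 2 / 4 * (((m (f i) : ℝ) - m (f j)) ^ 2 + (√3) ^ 2 * ((jj (f i) : ℝ) - jj (f j)) ^ 2) := by rw [hh]; ring
    show s ^ 2 ≤ _
    simp only
    rw [e, h3]
    nlinarith [sq_nonneg s]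

lemma norm_small (e : EuclideanSpace ℝ (Fin 2)) (a : ℝ) (ha : 0 ≤ a) (h0 : |e 0| ≤ a) (h1 : |e 1| ≤ a) : ‖e‖ ≤ 1.4143 * a := by
  rw [EuclideanSpace.norm_eq, Fin.sum_univ_two, Real.sqrt_le_left (by positivity)]
  simp only [Real.norm_eq_abs, sq_abs]
  have := sq_le_sq' (abs_le.1 h0).1 (abs_le.1 h0).2
  have := sq_le_sq' (abs_le.1 h1).1 (abs_le.1 h1).2
  nlinarith

/-- A box with given corner and side. -/
def boxCell (x y a : ℝ) : Set (EuclideanSpace ℝ (Fin 2)) :=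
  {p | p 0 ∈ Set.Icc x (x + a) ∧ p 1 ∈ Set.Icc y (y + a)}

lemma boxCell_eq (x y a : ℝ) : boxCell x y a =
    (WithLp.ofLp : EuclideanSpace ℝ (Fin 2) → (Fin 2 → ℝ)) ⁻¹' Set.Icc ![x, y] ![x + a, y + a] := by
  ext p
  simp only [boxCell, Set.mem_ofPred_eq, Set.mem_preimage, Set.mem_Icc, Pi.le_def, Fin.forall_fin_two]
  simp
  tauto

lemma boxCell_meas (x y a : ℝ) : MeasurableSet (boxCell x y a) := by
  rw [boxCell_eq]
  exact (PiLp.volume_preserving_ofLp (Fin 2)).measurable measurableSet_Icc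

lemma boxCell_vol (x y a : ℝ) (ha : 0 ≤ a) : volume (boxCell x y a) = ENNReal.ofReal (a ^ 2) := by
  rw [boxCell_eq, (PiLp.volume_preserving_ofLp (Fin 2)).measure_preimage measurableSet_Icc.nullMeasurableSet,
    Real.volume_Icc_pi, Fin.prod_univ_two]
  simp [← ENNReal.ofReal_mul ha, sq]

lemma unitSquare_eq : unitSquare = boxCell 0 0 1 := by
  ext p
  simp only [unitSquare, boxCell, Set.mem_ofPred_eq, Fin.forall_fin_two, zero_add]

lemma unitSquare_meas : MeasurableSet unitSquare := by rw [unitSquare_eq]; exact boxCell_meas _ _ _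

instance unif_prob : IsProbabilityMeasure unifSquare := by
  constructor
  rw [unifSquare, Measure.restrict_apply_univ, unitSquare_eq, boxCell_vol _ _ _ zero_le_one]
  simp

instance unif_noatoms : NullSingletonClass unifSquare := by
  unfold unifSquare; infer_instance

lemma unif_compl (x y a : ℝ) (ha : 0 ≤ a) (hx : 0 ≤ x) (hy : 0 ≤ y) (hx1 : x + a ≤ 1) (hy1 : y + a ≤ 1) :
    unifSquare (boxCell x y a)ᶜ = ENNReal.ofReal (1 - a ^ 2) := by
  rw [prob_compl_eq_one_sub (boxCell_meas x y a)]
  have : unifSquare (boxCell x y a) = ENNReal.ofReal (a ^ 2) := by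
    rw [unifSquare, Measure.restrict_apply (boxCell_meas x y a), Set.inter_eq_left.2, boxCell_vol x y a ha]
    rw [unitSquare_eq]
    rintro p ⟨⟨h1, h2⟩, h3, h4⟩
    exact ⟨⟨by linarith, by linarith⟩, by linarith, by linarith⟩
  rw [this, ENNReal.ofReal_sub _ (by positivity), ENNReal.ofReal_one]

lemma null_coll (n : ℕ) (i j : Fin n) (hij : i ≠ j) :
    (Measure.pi fun _ : Fin n => unifSquare) {X | X i = X j} = 0 := by
  have hind := ProbabilityTheory.iIndepFun_pi (μ := fun _ : Fin n => unifSquare) (X := fun _ => id) (fun _ => aemeasurable_id)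
  have h2 := hind.indepFun hij
  simp only [id] at h2
  have hmp := fun l : Fin n => measurePreserving_eval (fun _ : Fin n => unifSquare) l
  have h3 := (ProbabilityTheory.indepFun_iff_map_prod_eq_prod_map_map (measurable_pi_apply i).aemeasurable (measurable_pi_apply j).aemeasurable).1 h2
  have e : ∀ l : Fin n, (Measure.pi fun _ : Fin n => unifSquare).map (fun X => X l) = unifSquare := fun l => (hmp l).map_eq
  rw [e, e] at h3
  have hd : MeasurableSet (Set.diagonal (EuclideanSpace ℝ (Fin 2))) := measurableSet_diagonal
  have : (Measure.pi fun _ : Fin n => unifSquare) {X | X i = X j} = (unifSquare.prod unifSquare) (Set.diagonal _) := by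
    rw [← h3, Measure.map_apply (by fun_prop) hd]; rfl
  rw [this, Measure.measure_prod_null hd]
  filter_upwards with x
  have : Prod.mk x ⁻¹' Set.diagonal (EuclideanSpace ℝ (Fin 2)) = {x} := by
    ext y; simp [eq_comm]
  rw [this]; simp

lemma null_out (n : ℕ) (i : Fin n) :
    (Measure.pi fun _ : Fin n => unifSquare) {X | X i ∉ unitSquare} = 0 := by
  have := (measurePreserving_eval (fun _ : Fin n => unifSquare) i).measure_preimage unitSquare_meas.compl.nullMeasurableSet
  refine Eq.trans ?_ (this.trans ?_)
  · rfl
  · rw [unifSquare, Measure.restrict_apply unitSquare_meas.compl]; simp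

lemma miss_prob (n k : ℕ) (hn : 3 ≤ n) (hk : 3 * 10 ^ 5 ≤ k) (hkn : (k : ℝ) ≤ (n : ℝ) / (10 ^ 5 * Real.log n)) (x y : ℝ)
    (hx : 0 ≤ x) (hy : 0 ≤ y) (hx1 : x + 0.0045 / √k ≤ 1) (hy1 : y + 0.0045 / √k ≤ 1) :
    (Measure.pi fun _ : Fin n => unifSquare) {X | ∀ i, X i ∉ boxCell x y (0.0045 / √k)} ≤ ENNReal.ofReal (1 / (n:ℝ) ^ 2) := by
  have hw := sqrt_k_lb k hk
  set a := 0.0045 / √k with ha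
  have ha0 : 0 < a := by positivity
  have hk0 : (0:ℝ) < k := by have : 0 < k := by omega
                             exact_mod_cast this
  have ha2 : a ^ 2 * k = 0.0045 ^ 2 := by
    rw [ha, div_pow, Real.sq_sqrt hk0.le]; field_simp
  have hn0 : (0:ℝ) < n := by have : 0 < n := by omega
                             exact_mod_cast this
  have hlog : 0 < Real.log n := Real.log_pos (by have : 1 < n := by omega
                                                 exact_mod_cast this)
  have ha1 : a ^ 2 ≤ 1 := by
    have : a ≤ 1 := by linarith
    nlinarith
  have e : {X : Fin n → EuclideanSpace ℝ (Fin 2) | ∀ i, X i ∉ boxCell x y a} = Set.univ.pi fun _ => (boxCell x y a)ᶜ := by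
    ext X; simp [Set.mem_pi]
  rw [e, Measure.pi_pi, Finset.prod_const, unif_compl x y a ha0.le hx hy hx1 hy1, ← ENNReal.ofReal_pow (by linarith)]
  apply ENNReal.ofReal_le_ofReal
  simp only [Finset.card_univ, Fintype.card_fin]
  have h1 : 1 - a ^ 2 ≤ Real.exp (-a ^ 2) := by have := Real.add_one_le_exp (-a ^ 2); linarith
  calc (1 - a ^ 2) ^ n ≤ Real.exp (-a ^ 2) ^ n := by gcongr
    _ = Real.exp (n * (-a ^ 2)) := (Real.exp_nat_mul _ _).symm
    _ ≤ Real.exp (-(2 * Real.log n)) := by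
        apply Real.exp_le_exp.2
        rw [le_div_iff₀ (by positivity)] at hkn
        have h2 : a ^ 2 * (k * (10 ^ 5 * Real.log n)) ≤ a ^ 2 * n := by gcongr
        have h3 : a ^ 2 * (k * (10 ^ 5 * Real.log n)) = 2.025 * Real.log n := by
          rw [← mul_assoc, ha2]; ring
        nlinarith
    _ = 1 / (n:ℝ) ^ 2 := by
        rw [Real.exp_neg, two_mul, Real.exp_add, Real.exp_log hn0]; field_simp

lemma good_det (n k : ℕ) (hk : 3 * 10 ^ 5 ≤ k) (cx cy : Fin k → ℝ)
    (hc : ∀ i j, i ≠ j → (1.073 / √k) ^ 2 ≤ (cx i - cx j) ^ 2 + (cy i - cy j) ^ 2)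
    (X : Fin n → EuclideanSpace ℝ (Fin 2)) 
    (hX : ∀ i : Fin k, ∃ l, X l ∈ boxCell (cx i) (cy i) (0.0045 / √k)) :
    cOne / √k ≤ disp (Finset.image X Finset.univ) k := by
  have hw := sqrt_k_lb k hk
  have hw0 : 0 < √(k:ℝ) := by linarith
  choose g hg using hX
  have hcp : 0 < cOne / √k := div_pos cOne_pos hw0
  have hd : ∀ i j, i ≠ j → cOne / √k ≤ dist (X (g i)) (X (g j)) := by
    intro i j hij
    have h := hc i j hij
    obtain ⟨⟨p1, p2⟩, p3, p4⟩ := hg i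
    obtain ⟨⟨q1, q2⟩, q3, q4⟩ := hg j
    set p := X (g i)
    set q := X (g j)
    let C : Fin k → EuclideanSpace ℝ (Fin 2) := fun i => !₂[cx i, cy i]
    have hC : 1.073 / √k ≤ ‖C i - C j‖ := by
      rw [EuclideanSpace.norm_eq, Fin.sum_univ_two]
      apply Real.le_sqrt_of_sq_le
      simpa [C] using h
    have hsm : ‖(C i - p) - (C j - q)‖ ≤ 1.4143 * (0.0045 / √k) := by
      apply norm_small _ _ (by positivity)
      · have : ((C i - p) - (C j - q)) 0 = (cx i - p 0) - (cx j - q 0) := by simp [C]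
        rw [this, abs_le]; constructor <;> linarith
      · have : ((C i - p) - (C j - q)) 1 = (cy i - p 1) - (cy j - q 1) := by simp [C]
        rw [this, abs_le]; constructor <;> linarith
    have htri : ‖C i - C j‖ ≤ ‖p - q‖ + ‖(C i - p) - (C j - q)‖ := by
      refine le_trans (le_of_eq ?_) (norm_add_le _ _)
      congr 1; abel
    rw [dist_eq_norm]
    have : cOne / √k ≤ 1.0666 / √k := by gcongr; exact cOne_lt.le
    have e : 1.0666 / √k ≤ 1.073 / √k - 1.4143 * (0.0045 / √k) := by
      rw [← mul_div_assoc, ← sub_div]; gcongr; norm_num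
    linarith
  have hinj : Function.Injective (fun i => X (g i)) := by
    intro i j hij
    by_contra hne
    have := hd i j hne
    simp only at hij
    rw [hij, dist_self] at this
    linarith
  let S := Finset.image (fun i => X (g i)) Finset.univ
  have hScard : S.card = k := by rw [Finset.card_image_of_injective _ hinj]; simp
  refine le_trans (le_minDist (by omega) ?_) (le_disp (S := S) ?_ hScard)
  · intro p hp q hq hpq
    obtain ⟨i, _, rfl⟩ := Finset.mem_image.1 hp
    obtain ⟨j, _, rfl⟩ := Finset.mem_image.1 hq
    exact hd i j (fun h => hpq (by rw [h]))
  · intro p hp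
    obtain ⟨i, _, rfl⟩ := Finset.mem_image.1 hp
    exact Finset.mem_image.2 ⟨g i, Finset.mem_univ _, rfl⟩

theorem random_points_dispersion_approximation :
    ∃ N₀ : ℕ, ∀ n : ℕ, N₀ ≤ n → ∀ k : ℕ, 3 * 10 ^ 5 ≤ k →
      (k : ℝ) ≤ (n : ℝ) / (10 ^ 5 * Real.log n) →
      1 - 1 / (n : ℝ≥0∞) ≤
        (Measure.pi fun _ : Fin n => unifSquare)
          {X : Fin n → EuclideanSpace ℝ (Fin 2) |
            Function.Injective X ∧
            (letI c₁ : ℝ := (0.995 : ℝ) ^ ((3 : ℝ) / 2) * Real.sqrt 3 *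
                ((4 : ℝ) / 27) ^ ((1 : ℝ) / 4)
             letI P : Finset (EuclideanSpace ℝ (Fin 2)) := Finset.image X Finset.univ
             0.99 * disp P k ≤ c₁ / Real.sqrt k ∧ c₁ / Real.sqrt k ≤ disp P k ∧
               ∀ S ⊆ P, S.card = k →
                 (∀ p ∈ S, ∀ q ∈ S, p ≠ q → c₁ / Real.sqrt k ≤ dist p q) →
                 0.99 * disp P k ≤ minDist S)} := by
  refine ⟨3, fun n hn k hk hkn => ?_⟩
  change 1 - 1 / (n : ℝ≥0∞) ≤ (Measure.pi fun _ : Fin n => unifSquare)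
          {X : Fin n → EuclideanSpace ℝ (Fin 2) |
            Function.Injective X ∧
             0.99 * disp (Finset.image X Finset.univ) k ≤ cOne / Real.sqrt k ∧ cOne / Real.sqrt k ≤ disp (Finset.image X Finset.univ) k ∧
               ∀ S ⊆ Finset.image X Finset.univ, S.card = k →
                 (∀ p ∈ S, ∀ q ∈ S, p ≠ q → cOne / Real.sqrt k ≤ dist p q) →
                 0.99 * disp (Finset.image X Finset.univ) k ≤ minDist S}
  obtain ⟨cx, cy, hcin, hcd⟩ := hex_grid k hk
  set μ := (Measure.pi fun _ : Fin n => unifSquare) with hμ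
  set A := {X : Fin n → EuclideanSpace ℝ (Fin 2) |
            Function.Injective X ∧
             0.99 * disp (Finset.image X Finset.univ) k ≤ cOne / Real.sqrt k ∧ cOne / Real.sqrt k ≤ disp (Finset.image X Finset.univ) k ∧
               ∀ S ⊆ Finset.image X Finset.univ, S.card = k →
                 (∀ p ∈ S, ∀ q ∈ S, p ≠ q → cOne / Real.sqrt k ≤ dist p q) →
                 0.99 * disp (Finset.image X Finset.univ) k ≤ minDist S} with hA
  let B1 : Set (Fin n → EuclideanSpace ℝ (Fin 2)) := ⋃ i : Fin n, ⋃ j : Fin n, ⋃ _ : i ≠ j, {X | X i = X j}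
  let B2 : Set (Fin n → EuclideanSpace ℝ (Fin 2)) := ⋃ i : Fin n, {X | X i ∉ unitSquare}
  let B3 : Set (Fin n → EuclideanSpace ℝ (Fin 2)) := ⋃ c : Fin k, {X | ∀ i, X i ∉ boxCell (cx c) (cy c) (0.0045 / √k)}
  have hB1 : μ B1 = 0 := by
    simp only [B1, measure_iUnion_null_iff]
    exact fun i j hij => null_coll n i j hij
  have hB2 : μ B2 = 0 := by
    simp only [B2, measure_iUnion_null_iff]
    exact fun i => null_out n i
  have hn0 : (0:ℝ) < n := by have : 0 < n := by omega
                             exact_mod_cast this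
  have hkn' : (k:ℝ) ≤ n := by
    refine hkn.trans (div_le_self hn0.le ?_)
    have : 1 ≤ Real.log n := by
      rw [Real.le_log_iff_exp_le hn0]
      have : (3:ℝ) ≤ n := by exact_mod_cast hn
      linarith [Real.exp_one_lt_d9]
    linarith
  have hB3 : μ B3 ≤ 1 / (n : ℝ≥0∞) := by
    calc μ B3 ≤ ∑ c : Fin k, μ {X | ∀ i, X i ∉ boxCell (cx c) (cy c) (0.0045 / √k)} := measure_iUnion_fintype_le _ _
      _ ≤ ∑ c : Fin k, ENNReal.ofReal (1 / (n:ℝ) ^ 2) := by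
          refine Finset.sum_le_sum fun c _ => ?_
          obtain ⟨h1, h2, h3, h4⟩ := hcin c
          exact miss_prob n k hn hk hkn _ _ h1 h3 h2 h4
      _ = ENNReal.ofReal (k * (1 / (n:ℝ) ^ 2)) := by
          rw [Finset.sum_const, nsmul_eq_mul, Finset.card_univ, Fintype.card_fin, ENNReal.ofReal_mul (by positivity), ENNReal.ofReal_natCast]
      _ ≤ ENNReal.ofReal (1 / n) := by
          apply ENNReal.ofReal_le_ofReal
          calc (k:ℝ) * (1 / (n:ℝ) ^ 2) ≤ n * (1 / (n:ℝ) ^ 2) := by gcongr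
            _ = 1 / (n:ℝ) := by field_simp
      _ = 1 / (n : ℝ≥0∞) := by
          rw [ENNReal.ofReal_div_of_pos hn0, ENNReal.ofReal_one, ENNReal.ofReal_natCast]
  have hsub : Set.univ ⊆ A ∪ (B1 ∪ B2 ∪ B3) := by
    intro X _
    by_cases hX : X ∈ B1 ∪ B2 ∪ B3
    · exact Or.inr hX
    left
    simp only [B1, B2, B3, Set.mem_union, Set.mem_iUnion, Set.mem_ofPred_eq, not_or, not_exists, not_forall, not_not] at hX
    obtain ⟨⟨h1, h2⟩, h3⟩ := hX
    have hinj : Function.Injective X := by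
      intro i j hij
      by_contra hne
      exact h1 i j hne hij
    have hup := disp_upper k hk (Finset.image X Finset.univ) (by
      intro p hp
      obtain ⟨i, _, rfl⟩ := Finset.mem_image.1 hp
      exact h2 i)
    refine ⟨hinj, hup, good_det n k hk cx cy hcd X h3, ?_⟩
    intro S hS hSc hSd
    exact hup.trans (le_minDist (by omega) hSd)
  have htot : 1 ≤ μ A + 1 / (n : ℝ≥0∞) := by
    calc (1 : ℝ≥0∞) = μ Set.univ := measure_univ.symm
      _ ≤ μ (A ∪ (B1 ∪ B2 ∪ B3)) := measure_mono hsub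
      _ ≤ μ A + μ (B1 ∪ B2 ∪ B3) := measure_union_le _ _
      _ ≤ μ A + (μ B1 + μ B2 + μ B3) := by
          gcongr
          exact (measure_union_le _ _).trans (by gcongr; exact measure_union_le _ _)
      _ ≤ μ A + 1 / (n : ℝ≥0∞) := by
          rw [hB1, hB2]; simpa using add_le_add_right hB3 (μ A)
  exact tsub_le_iff_right.2 htot
end
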